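/- arXiv:2605.19096 — 2 statements merged into one kernel-verified Lean document; each statement's English description precedes it below -/
import Mathlib

section
/- Let Ω ∈ K^{n×ℓ} be a random orthonormal embedding, and let A ∈ K^{n×d} and B ∈ K^{n×p} be matrices with r := rank(A) < ℓ − α_K. Then the sketch-and-solve solution X̂ = (Ω*A)⁺(Ω*B) satisfies E‖B − AX̂‖_F² = (1 + ((n − ℓ)/(n − r)) · r/(ℓ − r − α_K)) · min_{X ∈ K^{d×p}} ‖B − AX‖_F². -/
open MeasureTheory ProbabilityTheory Matrix Filter
open scoped ENNReal Topology ComplexOrder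

noncomputable section

open Classical in
/-- `α_K`: 1 if `K = ℝ`, 0 if `K = ℂ`. -/
def alphaK (K : Type*) [RCLike K] : ℝ := if (RCLike.I : K) = 0 then 1 else 0

/-- Squared Frobenius norm of a matrix. -/
def frobSq {K : Type*} [RCLike K] {m n : Type*} [Fintype m] [Fintype n]
    (A : Matrix m n K) : ℝ := ∑ i, ∑ j, ‖A i j‖ ^ 2

/-- The four Penrose conditions characterizing the Moore–Penrose pseudoinverse. -/
def IsMoorePenrose {K : Type*} [RCLike K] {m n : Type*} [Fintype m] [Fintype n]
    (A : Matrix m n K) (X : Matrix n m K) : Prop :=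
  A * X * A = A ∧ X * A * X = X ∧ (A * X)ᴴ = A * X ∧ (X * A)ᴴ = X * A

instance matrixMeasurableSpace {m n α : Type*} [MeasurableSpace α] :
    MeasurableSpace (Matrix m n α) :=
  inferInstanceAs (MeasurableSpace (m → n → α))

/-- `M` is rotation-invariant: `U * M` has the same distribution as `M` for every unitary `U`. -/
def RotationInvariant {K : Type*} [RCLike K] [MeasurableSpace K]
    {Y : Type*} [MeasurableSpace Y] (μ : Measure Y) {n ℓ : ℕ}
    (M : Y → Matrix (Fin n) (Fin ℓ) K) : Prop :=
  ∀ U : Matrix (Fin n) (Fin n) K, U ∈ Matrix.unitaryGroup (Fin n) K →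
    Measure.map (fun ω => U * M ω) μ = Measure.map M μ

/-- `M` is a random orthonormal embedding: rotation-invariant, with orthonormal
columns almost surely. -/
def IsRandomOrthonormal {K : Type*} [RCLike K] [MeasurableSpace K]
    {Y : Type*} [MeasurableSpace Y] (μ : Measure Y) {n ℓ : ℕ}
    (M : Y → Matrix (Fin n) (Fin ℓ) K) : Prop :=
  Measurable M ∧ RotationInvariant μ M ∧ ∀ᵐ ω ∂μ, (M ω)ᴴ * M ω = 1

lemma gauss1 {t : ℝ} (ht : 0 ≤ t) :
    ∫ x, Real.exp (-t * x ^ 2) ∂(gaussianReal 0 1) = (1 + 2 * t) ^ (-(1/2) : ℝ) := by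
  rw [integral_gaussianReal_eq_integral_smul (by norm_num)]
  simp only [gaussianPDFReal, smul_eq_mul, sub_zero, NNReal.coe_one, mul_one]
  have : ∀ x : ℝ, (√(2 * Real.pi))⁻¹ * Real.exp (-x ^ 2 / 2) * Real.exp (-t * x ^ 2)
      = (√(2 * Real.pi))⁻¹ * Real.exp (-(1/2 + t) * x ^ 2) := by
    intro x
    rw [mul_assoc, ← Real.exp_add]; congr 2; ring
  simp_rw [this]
  rw [integral_const_mul, integral_gaussian, ← Real.sqrt_inv, ← Real.sqrt_mul (by positivity),
    Real.rpow_neg (by positivity), ← Real.sqrt_eq_rpow, ← Real.sqrt_inv]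
  congr 1
  have := Real.pi_pos
  field_simp
  

lemma gaussE {E : Type*} [NormedAddCommGroup E] [InnerProductSpace ℝ E] [FiniteDimensional ℝ E]
    [MeasurableSpace E] [BorelSpace E] {t : ℝ} (ht : 0 ≤ t) :
    ∫ x, Real.exp (-t * ‖x‖ ^ 2) ∂(stdGaussian E)
      = (1 + 2 * t) ^ (-((Module.finrank ℝ E : ℝ) / 2)) := by
  rw [stdGaussian, integral_map (Measurable.aemeasurable (by fun_prop))
    (Measurable.aestronglyMeasurable (by fun_prop))]
  have : ∀ x : Fin (Module.finrank ℝ E) → ℝ,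
      Real.exp (-t * ‖∑ i, x i • stdOrthonormalBasis ℝ E i‖ ^ 2)
        = ∏ i, Real.exp (-t * x i ^ 2) := by
    intro x
    rw [← Real.exp_sum, ← Finset.mul_sum]
    congr 2
    rw [← real_inner_self_eq_norm_sq, (stdOrthonormalBasis ℝ E).orthonormal.inner_sum]
    simp [sq]
  simp_rw [this]
  rw [integral_fintype_prod_eq_prod (f := fun _ x => Real.exp (-t * x ^ 2))]
  simp only [gauss1 ht, Finset.prod_const, Finset.card_univ, Fintype.card_fin]
  rw [← Real.rpow_natCast, ← Real.rpow_mul (by positivity)]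
  congr 1; ring

lemma lint_exp {a : ℝ} (ha : 0 ≤ a) :
    ∫⁻ t in Set.Ioi (0:ℝ), ENNReal.ofReal (Real.exp (-t * a)) = (ENNReal.ofReal a)⁻¹ := by
  rcases ha.eq_or_lt with rfl | ha
  · simp
  · have h1 : ∀ t : ℝ, -t * a = (-a) * t := fun t => by ring
    simp_rw [h1]
    rw [← ofReal_integral_eq_lintegral_ofReal]
    · rw [integral_exp_mul_Ioi (by linarith), ← ENNReal.ofReal_inv_of_pos ha]
      congr 1; simp
    · exact integrableOn_exp_mul_Ioi (by linarith) 0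
    · exact ae_of_all _ fun t => (Real.exp_pos _).le

/-- `E 1/‖g‖²` for a standard Gaussian in dimension `m`. -/
lemma gauss_inv {E : Type*} [NormedAddCommGroup E] [InnerProductSpace ℝ E]
    [FiniteDimensional ℝ E] [MeasurableSpace E] [BorelSpace E]
    (h : 2 < (Module.finrank ℝ E : ℝ)) :
    ∫⁻ x, (ENNReal.ofReal (‖x‖ ^ 2))⁻¹ ∂(stdGaussian E)
      = ENNReal.ofReal (1 / ((Module.finrank ℝ E : ℝ) - 2)) := by
  simp_rw [← fun x : E => lint_exp (sq_nonneg ‖x‖)]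
  rw [lintegral_lintegral_swap (Measurable.aemeasurable (by fun_prop))]
  set m : ℝ := (Module.finrank ℝ E : ℝ) with hm
  have h1 : ∀ t ∈ Set.Ioi (0:ℝ), ∫⁻ x, ENNReal.ofReal (Real.exp (-t * ‖x‖ ^ 2)) ∂(stdGaussian E)
      = ENNReal.ofReal ((1 + 2 * t) ^ (-(m / 2))) := by
    intro t ht
    rw [← gaussE (le_of_lt ht), ofReal_integral_eq_lintegral_ofReal]
    · refine Integrable.of_bound (C := 1) (Measurable.aestronglyMeasurable (by fun_prop)) ?_
      refine ae_of_all _ fun x => ?_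
      rw [Real.norm_of_nonneg (Real.exp_pos _).le, Real.exp_le_one_iff]
      have : (0:ℝ) < t := ht
      nlinarith [sq_nonneg ‖x‖]
    · exact ae_of_all _ fun t => (Real.exp_pos _).le
  rw [setLIntegral_congr_fun measurableSet_Ioi h1]
  have hd : ∀ t ∈ Set.Ioi (0:ℝ), HasDerivAt (fun t : ℝ => -(1 / (m - 2)) * (1 + 2 * t) ^ (1 - m / 2))
      ((1 + 2 * t) ^ (-(m / 2))) t := by
    intro t ht
    have ht' : (0:ℝ) < t := ht
    have h2 : HasDerivAt (fun t : ℝ => 1 + 2 * t) 2 t := by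
      simpa using ((hasDerivAt_id t).const_mul 2).const_add 1
    have h3 := (h2.rpow_const (p := 1 - m/2) (Or.inl (by positivity))).const_mul (-(1 / (m - 2)))
    refine h3.congr_deriv ?_
    rw [show 1 - m / 2 - 1 = -(m/2) by ring]
    have : m - 2 ≠ 0 := by linarith
    field_simp
    ring
  have hc : ContinuousWithinAt (fun t : ℝ => -(1 / (m - 2)) * (1 + 2 * t) ^ (1 - m / 2))
      (Set.Ici 0) 0 := by
    refine ContinuousAt.continuousWithinAt ?_
    refine continuousAt_const.mul (ContinuousAt.rpow_const (by fun_prop) (Or.inl (by norm_num)))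
  have hl : Tendsto (fun t : ℝ => -(1 / (m - 2)) * (1 + 2 * t) ^ (1 - m / 2)) atTop (𝓝 0) := by
    rw [show (0:ℝ) = -(1 / (m - 2)) * 0 by ring]
    refine Tendsto.const_mul _ ?_
    have := tendsto_rpow_neg_atTop (y := m/2 - 1) (by linarith)
    have h4 : Tendsto (fun t : ℝ => 1 + 2 * t) atTop atTop :=
      tendsto_atTop_add_const_left _ _ (tendsto_id.const_mul_atTop (by norm_num))
    have h5 := this.comp h4
    refine h5.congr fun t => ?_
    simp only [Function.comp]
    congr 1; ring
  have hp : ∀ t ∈ Set.Ioi (0:ℝ), 0 ≤ (1 + 2 * t) ^ (-(m / 2)) := by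
    intro t ht
    have ht' : (0:ℝ) < t := ht
    positivity
  rw [← ofReal_integral_eq_lintegral_ofReal]
  · rw [integral_Ioi_of_hasDerivAt_of_nonneg hc hd hp hl]
    simp
  · exact integrableOn_Ioi_deriv_of_nonneg hc hd hp hl
  · exact (ae_restrict_mem measurableSet_Ioi).mono hp

lemma gauss_coisom {E F : Type*} [NormedAddCommGroup E] [InnerProductSpace ℝ E]
    [FiniteDimensional ℝ E] [MeasurableSpace E] [BorelSpace E]
    [NormedAddCommGroup F] [InnerProductSpace ℝ F]
    [FiniteDimensional ℝ F] [MeasurableSpace F] [BorelSpace F]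
    (L : E → F) (hLm : Measurable L) (L' : F → E) (hadj : ∀ x y, inner ℝ (L x) y = inner ℝ x (L' y))
    (hL : ∀ y, ‖L' y‖ = ‖y‖) : (stdGaussian E).map L = stdGaussian F := by
  have : IsProbabilityMeasure ((stdGaussian E).map L) :=
    Measure.isProbabilityMeasure_map hLm.aemeasurable
  apply Measure.ext_of_charFun
  ext t
  rw [charFun_stdGaussian, charFun_apply, integral_map hLm.aemeasurable
    (Measurable.aestronglyMeasurable (by fun_prop))]
  simp_rw [hadj]
  rw [← charFun_apply, charFun_stdGaussian, hL]

lemma finDimReal (K : Type*) [RCLike K] (E : Type*) [NormedAddCommGroup E] [InnerProductSpace K E]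
    [FiniteDimensional K E] :
    letI := InnerProductSpace.rclikeToReal K E
    FiniteDimensional ℝ E := by
  let := InnerProductSpace.rclikeToReal K E
  have : IsScalarTower ℝ K E := RestrictScalars.isScalarTower ℝ K E
  exact Module.Finite.trans K E

lemma finrankReal (K : Type*) [RCLike K] (E : Type*) [NormedAddCommGroup E]
    [InnerProductSpace K E] [FiniteDimensional K E] :
    letI := InnerProductSpace.rclikeToReal K E
    Module.finrank ℝ E = Module.finrank ℝ K * Module.finrank K E := by
  let := InnerProductSpace.rclikeToReal K E
  have : IsScalarTower ℝ K E := RestrictScalars.isScalarTower ℝ K E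
  exact (Module.finrank_mul_finrank ℝ K E).symm

/-- Standard Gaussian measure on a finite-dimensional inner product space over `K`. -/
def gaussK (K : Type*) [RCLike K] (E : Type*) [NormedAddCommGroup E] [InnerProductSpace K E]
    [FiniteDimensional K E] [MeasurableSpace E] : Measure E :=
  let := InnerProductSpace.rclikeToReal K E
  have := finDimReal K E
  stdGaussian E

instance (K : Type*) [RCLike K] (E : Type*) [NormedAddCommGroup E] [InnerProductSpace K E]
    [FiniteDimensional K E] [MeasurableSpace E] [BorelSpace E] :
    IsProbabilityMeasure (gaussK K E) := by
  let := InnerProductSpace.rclikeToReal K E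
  have := finDimReal K E
  exact isProbabilityMeasure_stdGaussian (E := E)

lemma gaussK_inv (K : Type*) [RCLike K] (E : Type*) [NormedAddCommGroup E] [InnerProductSpace K E]
    [FiniteDimensional K E] [MeasurableSpace E] [BorelSpace E]
    (h : 2 < (Module.finrank ℝ K : ℝ) * Module.finrank K E) :
    ∫⁻ x, (ENNReal.ofReal (‖x‖ ^ 2))⁻¹ ∂(gaussK K E)
      = ENNReal.ofReal (1 / ((Module.finrank ℝ K : ℝ) * Module.finrank K E - 2)) := by
  let := InnerProductSpace.rclikeToReal K E
  have := finDimReal K E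
  have h1 := finrankReal K E
  have := gauss_inv (E := E)
  rw [h1] at this
  push_cast at this
  exact this h

lemma gaussK_coisom (K : Type*) [RCLike K] {E F : Type*} [NormedAddCommGroup E]
    [InnerProductSpace K E]
    [FiniteDimensional K E] [MeasurableSpace E] [BorelSpace E] [NormedAddCommGroup F]
    [InnerProductSpace K F]
    [FiniteDimensional K F] [MeasurableSpace F] [BorelSpace F] 
    (L : E → F) (hLm : Measurable L) (L' : F → E) (hadj : ∀ x y, inner K (L x) y = inner K x (L' y))
    (hL : ∀ y, ‖L' y‖ = ‖y‖) : (gaussK K E).map L = gaussK K F := by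
  let := InnerProductSpace.rclikeToReal K E
  have := finDimReal K E
  let := InnerProductSpace.rclikeToReal K F
  have := finDimReal K F
  refine gauss_coisom L hLm L' (fun x y => ?_) hL
  change RCLike.re (inner K (L x) y) = RCLike.re (inner K x (L' y))
  rw [hadj]

abbrev EE (K : Type*) (n : ℕ) := EuclideanSpace K (Fin n)

/-- Squared distance of `Ωᴴ g` to `Ωᴴ H`. -/
def delta {K : Type*} [RCLike K] {n l : ℕ} (H : Submodule K (EE K n))
    (Om : Matrix (Fin n) (Fin l) K) (g : EE K n) : ℝ≥0∞ :=
  ⨅ h : H, ENNReal.ofReal (‖toEuclideanLin Omᴴ (g + h)‖ ^ 2)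

lemma delta_eq {K : Type*} [RCLike K] {n l : ℕ} (H : Submodule K (EE K n))
    (Om : Matrix (Fin n) (Fin l) K) (g : EE K n) :
    delta H Om g = ENNReal.ofReal
      (‖(H.map (toEuclideanLin Omᴴ))ᗮ.orthogonalProjectionOnto (toEuclideanLin Omᴴ g)‖ ^ 2) := by
  set T := toEuclideanLin Omᴴ
  apply le_antisymm
  · have h1 : (H.map T).starProjection (T g) ∈ H.map T := Submodule.starProjection_apply_mem _ _
    obtain ⟨h, hh, hh'⟩ := h1
    refine (iInf_le _ ⟨-h, H.neg_mem hh⟩).trans (le_of_eq ?_)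
    change ENNReal.ofReal (‖T (g + -h)‖ ^ 2) = _
    congr 2
    rw [map_add, map_neg, hh', ← sub_eq_add_neg, ← Submodule.starProjection_orthogonal_val]
    rfl
  · refine le_iInf fun h => ?_
    gcongr
    have : (H.map T)ᗮ.orthogonalProjectionOnto (T g) = (H.map T)ᗮ.orthogonalProjectionOnto (T (g + h)) := by
      rw [map_add, map_add, Submodule.orthogonalProjectionOnto_apply_of_mem_orthogonal (v := T h), add_zero]
      rw [Submodule.orthogonal_orthogonal]
      exact ⟨h, h.2, rfl⟩
    rw [this]
    exact Submodule.norm_orthogonalProjectionOnto_apply_le _ _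

lemma inner_T {K : Type*} [RCLike K] {n l : ℕ}
    (Om : Matrix (Fin n) (Fin l) K) (x : EE K n) (y : EE K l) :
    inner K (toEuclideanLin Omᴴ x) y = inner K x (toEuclideanLin Om y) := by
  rw [Matrix.toEuclideanLin_conjTranspose_eq_adjoint, LinearMap.adjoint_inner_left]

lemma norm_Om {K : Type*} [RCLike K] {n l : ℕ}
    (Om : Matrix (Fin n) (Fin l) K) (hO : Omᴴ * Om = 1) (y : EE K l) :
    ‖toEuclideanLin Om y‖ = ‖y‖ := by
  have h : toEuclideanLin Omᴴ (toEuclideanLin Om y) = y := by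
    ext i
    simp [toLpLin_apply, hO]
  have h2 := inner_T Om (toEuclideanLin Om y) y
  rw [h] at h2
  have h3 := congrArg RCLike.re h2
  rw [inner_self_eq_norm_sq, inner_self_eq_norm_sq] at h3
  exact (sq_eq_sq₀ (norm_nonneg _) (norm_nonneg _)).1 h3.symm

lemma delta_gauss {K : Type*} [RCLike K] [MeasurableSpace K] [BorelSpace K] {n l : ℕ}
    (H : Submodule K (EE K n))
    (Om : Matrix (Fin n) (Fin l) K) (hO : Omᴴ * Om = 1)
    (h : 2 < (Module.finrank ℝ K : ℝ) * Module.finrank K (H.map (toEuclideanLin Omᴴ))ᗮ) :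
    ∫⁻ g : Hᗮ, (delta H Om g)⁻¹ ∂(gaussK K Hᗮ) = ENNReal.ofReal
      (1 / ((Module.finrank ℝ K : ℝ) * Module.finrank K (H.map (toEuclideanLin Omᴴ))ᗮ - 2)) := by
  rw [← gaussK_inv K _ h]
  simp_rw [delta_eq]
  set T := toEuclideanLin Omᴴ with hT
  set V := H.map T
  let L : Hᗮ →ₗ[K] Vᗮ := Vᗮ.orthogonalProjectionOnto.toLinearMap ∘ₗ T ∘ₗ Hᗮ.subtype
  have hL : Continuous L := LinearMap.continuous_of_finiteDimensional _
  have hmem : ∀ y : Vᗮ, toEuclideanLin Om (y : EE K l) ∈ Hᗮ := by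
    intro y
    rw [Submodule.mem_orthogonal]
    intro u hu
    rw [← inner_T]
    exact (Submodule.mem_orthogonal _ _).1 y.2 _ ⟨u, hu, rfl⟩
  have := gaussK_coisom K (E := Hᗮ) (F := Vᗮ) L hL.measurable
    (fun y => ⟨toEuclideanLin Om (y : EE K l), hmem y⟩) (fun x y => by
      change inner K (Vᗮ.orthogonalProjectionOnto (T x)) y = inner K (x : EE K n) (toEuclideanLin Om (y : EE K l))
      rw [← inner_T, Submodule.inner_orthogonalProjectionOnto_eq_of_mem_right]) (fun y => by
      change ‖toEuclideanLin Om (y : EE K l)‖ = ‖(y : EE K l)‖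
      exact norm_Om Om hO _)
  rw [← this, lintegral_map (by fun_prop) hL.measurable]
  rfl

lemma exists_unitary {K : Type*} [RCLike K] {n : ℕ} (H : Submodule K (EE K n)) (u e : EE K n)
    (hu : u ∈ Hᗮ) (he : e ∈ Hᗮ) (hue : ‖u‖ = ‖e‖) :
    ∃ U ∈ Matrix.unitaryGroup (Fin n) K, ∃ c : K, ‖c‖ = 1 ∧
      (∀ h ∈ H, toEuclideanLin U h = h) ∧ (∀ h ∈ H, toEuclideanLin Uᴴ h = h) ∧
      toEuclideanLin Uᴴ u = c • e := by
  obtain ⟨c, hc, hcz⟩ : ∃ c : K, ‖c‖ = 1 ∧ (starRingEnd K) (c * inner K u e) = c * inner K u e := by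
    by_cases hz : inner K u e = 0
    · exact ⟨1, by simp, by simp [hz]⟩
    · have hz' : (‖inner K u e‖ : ℝ) ≠ 0 := norm_ne_zero_iff.2 hz
      refine ⟨(starRingEnd K) (inner K u e) / (‖inner K u e‖ : ℝ), ?_, ?_⟩
      · rw [norm_div, RCLike.norm_conj, RCLike.norm_ofReal, abs_norm, div_self hz']
      · simp [mul_comm, div_eq_mul_inv]
        ring
  set w := c • e with hw
  have hwn : ‖w‖ = ‖u‖ := by rw [hw, norm_smul, hc, one_mul, hue]
  have hsym : inner K u w = inner K w u := by
    rw [← inner_conj_symm w u, hw, inner_smul_right, hcz]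
  set R := Submodule.reflection (K ∙ (u - w))ᗮ with hR
  have h1 : R (u - w) = -(u - w) := Submodule.reflection_orthogonalComplement_singleton_eq_neg _
  have h2 : R (u + w) = u + w := by
    apply Submodule.reflection_mem_subspace_eq_self
    rw [Submodule.mem_orthogonal_singleton_iff_inner_right, inner_sub_left, inner_add_right,
      inner_add_right, hsym, inner_self_eq_norm_sq_to_K, inner_self_eq_norm_sq_to_K, hwn]
    ring
  have h3 : R u = w := by
    rw [map_sub] at h1
    rw [map_add] at h2
    have h4 : (2 : K) • R u = (2 : K) • w := by
      rw [two_smul, two_smul]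
      have : R u + R u = (R u - R w) + (R u + R w) := by abel
      rw [this, h1, h2]; abel
    exact smul_right_injective _ (two_ne_zero) h4
  have h5 : ∀ h ∈ H, R h = h := by
    intro h hh
    apply Submodule.reflection_mem_subspace_eq_self
    rw [Submodule.mem_orthogonal_singleton_iff_inner_left]
    exact (Submodule.mem_orthogonal _ _).1 (Hᗮ.sub_mem hu (Hᗮ.smul_mem c he)) h hh
  have hRR : ∀ x, R (R x) = x := Submodule.reflection_reflection _
  let P : Matrix (Fin n) (Fin n) K := toEuclideanLin.symm R.toLinearMap
  have hP : ∀ x, toEuclideanLin P x = R x := by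
    intro x; simp [P]
  have hPP : P * P = 1 := by
    apply toEuclideanLin.injective
    ext1 x
    change toLpLin 2 2 (P * P) x = toLpLin 2 2 1 x
    rw [toLpLin_mul_same, LinearMap.comp_apply]
    erw [hP, hP, hRR]; simp
  have hPH : Pᴴ = P := by
    apply toEuclideanLin.injective
    rw [Matrix.toEuclideanLin_conjTranspose_eq_adjoint]
    symm
    rw [LinearMap.eq_adjoint_iff]
    intro x y
    rw [hP, hP, ← R.inner_map_map, hRR]
  refine ⟨P, ?_, c, hc, ?_, ?_, ?_⟩
  · rw [mem_unitaryGroup_iff, star_eq_conjTranspose, hPH, hPP]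
  · intro h hh; rw [hP, h5 h hh]
  · intro h hh; rw [hPH, hP, h5 h hh]
  · rw [hPH, hP, h3]

lemma delta_smul {K : Type*} [RCLike K] {n l : ℕ} (H : Submodule K (EE K n))
    (Om : Matrix (Fin n) (Fin l) K) (g : EE K n) (c : K) (hc : c ≠ 0) :
    delta H Om (c • g) = ENNReal.ofReal (‖c‖ ^ 2) * delta H Om g := by
  unfold delta
  have hc2 : 0 < ‖c‖ ^ 2 := by positivity
  rw [ENNReal.mul_iInf_of_ne (by simpa using hc2.ne') (by simp)]
  have key : ∀ h : EE K n, ENNReal.ofReal (‖c‖ ^ 2) * ENNReal.ofReal (‖toEuclideanLin Omᴴ (g + h)‖ ^ 2)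
      = ENNReal.ofReal (‖toEuclideanLin Omᴴ (c • g + c • h)‖ ^ 2) := by
    intro h
    rw [← ENNReal.ofReal_mul hc2.le, ← smul_add, map_smul, norm_smul, mul_pow]
  apply le_antisymm
  · refine le_iInf fun h => ?_
    rw [key]
    exact iInf_le (fun h : H => ENNReal.ofReal (‖toEuclideanLin Omᴴ (c • g + h)‖ ^ 2)) (c • h)
  · refine le_iInf fun h => ?_
    refine (iInf_le _ (c⁻¹ • h)).trans (le_of_eq ?_)
    rw [key]
    simp [smul_smul, hc]

lemma toE_mul {K : Type*} [RCLike K] {n m l : ℕ} (A : Matrix (Fin n) (Fin m) K)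
    (B : Matrix (Fin m) (Fin l) K) (x : EE K l) :
    toEuclideanLin (A * B) x = toEuclideanLin A (toEuclideanLin B x) := by
  change toLpLin 2 2 (A * B) x = toLpLin 2 2 A (toLpLin 2 2 B x)
  rw [toLpLin_mul_same, LinearMap.comp_apply]

lemma delta_rot {K : Type*} [RCLike K] {n l : ℕ} (H : Submodule K (EE K n)) (u e : EE K n)
    (hu : u ∈ Hᗮ) (he : e ∈ Hᗮ) (hue : ‖u‖ = ‖e‖) :
    ∃ U ∈ Matrix.unitaryGroup (Fin n) K, ∀ Om : Matrix (Fin n) (Fin l) K,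
      delta H (U * Om) u = delta H Om e := by
  obtain ⟨U, hU, c, hc, -, h2, h3⟩ := exists_unitary H u e hu he hue
  refine ⟨U, hU, fun Om => ?_⟩
  have hc0 : c ≠ 0 := by rintro rfl; simp at hc
  have := delta_smul H Om e c hc0
  rw [hc] at this
  simp only [one_pow, ENNReal.ofReal_one, one_mul] at this
  rw [← this]
  unfold delta
  congr! 5 with h
  rw [conjTranspose_mul, toE_mul, map_add (toEuclideanLin Uᴴ), h3, h2 h h.2]

instance matBorel {K : Type*} [RCLike K] [MeasurableSpace K] [BorelSpace K] {m n : Type*}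
    [Finite m] [Finite n] : BorelSpace (Matrix m n K) :=
  inferInstanceAs (BorelSpace (m → n → K))

instance matSC {K : Type*} [RCLike K] {m n : Type*}
    [Finite m] [Finite n] : SecondCountableTopology (Matrix m n K) :=
  inferInstanceAs (SecondCountableTopology (m → n → K))

lemma delta_meas {K : Type*} [RCLike K] [MeasurableSpace K] [BorelSpace K] {n l : ℕ}
    (H : Submodule K (EE K n)) :
    Measurable (fun q : Matrix (Fin n) (Fin l) K × EE K n => delta H q.1 q.2) := by
  apply UpperSemicontinuous.measurable
  apply upperSemicontinuous_iInf
  intro h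
  apply Continuous.upperSemicontinuous
  simp only [toLpLin_apply]
  refine ENNReal.continuous_ofReal.comp ?_
  fun_prop

lemma rot_lintegral {K : Type*} [RCLike K] [MeasurableSpace K] [BorelSpace K]
    {Y : Type*} [MeasurableSpace Y] {μ : Measure Y} {n l : ℕ}
    {M : Y → Matrix (Fin n) (Fin l) K} (hM : IsRandomOrthonormal μ M)
    {f : Matrix (Fin n) (Fin l) K → ℝ≥0∞} (hf : Measurable f)
    {U : Matrix (Fin n) (Fin n) K} (hU : U ∈ Matrix.unitaryGroup (Fin n) K) :
    ∫⁻ ω, f (U * M ω) ∂μ = ∫⁻ ω, f (M ω) ∂μ := by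
  rw [← lintegral_map hf hM.1, ← hM.2.1 U hU, lintegral_map hf]
  have : Measurable (fun A : Matrix (Fin n) (Fin l) K => U * A) :=
    Continuous.measurable (by fun_prop)
  exact this.comp hM.1

lemma core_eq {K : Type*} [RCLike K] [MeasurableSpace K] [BorelSpace K]
    {Y : Type*} [MeasurableSpace Y] {μ : Measure Y} [IsProbabilityMeasure μ] {n l : ℕ} (hln : l ≤ n)
    {M : Y → Matrix (Fin n) (Fin l) K} (hM : IsRandomOrthonormal μ M)
    (H : Submodule K (EE K n)) (e : EE K n) (he : e ∈ Hᗮ) (hen : ‖e‖ = 1)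
    (hd : 2 < (Module.finrank ℝ K : ℝ) * ((l : ℝ) - Module.finrank K H)) :
    (∫⁻ ω, (delta H (M ω) e)⁻¹ ∂μ) *
      ENNReal.ofReal (1 / ((Module.finrank ℝ K : ℝ) * ((n : ℝ) - Module.finrank K H) - 2)) =
    ∫⁻ ω, ENNReal.ofReal (1 / ((Module.finrank ℝ K : ℝ) *
      ((l : ℝ) - Module.finrank K (H.map (toEuclideanLin (M ω)ᴴ))) - 2)) ∂μ := by
  have hdm : ∀ u, Measurable fun A : Matrix (Fin n) (Fin l) K => (delta H A u)⁻¹ := by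
    intro u
    exact ((delta_meas H).comp (measurable_id.prodMk measurable_const)).inv
  -- constancy on the sphere
  have hconst : ∀ u ∈ Hᗮ, ‖u‖ = 1 →
      ∫⁻ ω, (delta H (M ω) u)⁻¹ ∂μ = ∫⁻ ω, (delta H (M ω) e)⁻¹ ∂μ := by
    intro u hu hun
    obtain ⟨U, hU, h⟩ := delta_rot (l := l) H u e hu he (hun.trans hen.symm)
    rw [← rot_lintegral hM (hdm u) hU]
    simp_rw [h]
  have hhom : ∀ g ∈ Hᗮ, g ≠ 0 → ∫⁻ ω, (delta H (M ω) g)⁻¹ ∂μ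
      = (∫⁻ ω, (delta H (M ω) e)⁻¹ ∂μ) * (ENNReal.ofReal (‖g‖ ^ 2))⁻¹ := by
    intro g hg hg0
    have hg1 : ‖g‖ ≠ 0 := norm_ne_zero_iff.2 hg0
    have hc : ((‖g‖ : ℝ) : K) ≠ 0 := by exact_mod_cast hg1
    set u : EE K n := ((‖g‖ : ℝ) : K)⁻¹ • g
    have hgu : g = ((‖g‖ : ℝ) : K) • u := by simp [u, smul_smul, hc]
    have hun : ‖u‖ = 1 := by simp [u, norm_smul, hg1]
    rw [← hconst u (Hᗮ.smul_mem _ hg) hun, ← lintegral_mul_const (f := fun ω => (delta H (M ω) u)⁻¹) _ ((hdm u).comp hM.1)]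
    refine lintegral_congr fun ω => ?_
    conv_lhs => rw [hgu, delta_smul _ _ _ _ hc]
    rw [RCLike.norm_ofReal, abs_norm]
    have : 0 < ‖g‖ ^ 2 := by positivity
    rw [ENNReal.mul_inv (Or.inl (by simpa using hg0)) (Or.inl (by simp)), mul_comm]
  have hrk : (Module.finrank K Hᗮ : ℝ) = (n : ℝ) - Module.finrank K H := by
    have := Submodule.finrank_add_finrank_orthogonal H
    rw [finrank_euclideanSpace_fin] at this
    rw [eq_sub_iff_add_eq, add_comm]; exact_mod_cast this
  have hrkV : ∀ V : Submodule K (EE K l), (Module.finrank K Vᗮ : ℝ) = (l : ℝ) - Module.finrank K V := by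
    intro V
    have := Submodule.finrank_add_finrank_orthogonal V
    rw [finrank_euclideanSpace_fin] at this
    rw [eq_sub_iff_add_eq, add_comm]; exact_mod_cast this
  have hln' : (l : ℝ) ≤ n := by exact_mod_cast hln
  have hN : 2 < (Module.finrank ℝ K : ℝ) * Module.finrank K Hᗮ := by
    rw [hrk]; refine hd.trans_le ?_
    gcongr
  have hCN := gaussK_inv K Hᗮ hN
  have hne : ∀ᵐ g : Hᗮ ∂(gaussK K Hᗮ), g ≠ 0 := by
    have := ae_lt_top (μ := gaussK K Hᗮ) (f := fun x : Hᗮ => (ENNReal.ofReal (‖x‖ ^ 2))⁻¹)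
      (by fun_prop) (by rw [hCN]; exact ENNReal.ofReal_ne_top)
    filter_upwards [this] with g hg h0
    simp [h0] at hg
  rw [← hrk, ← hCN, ← lintegral_const_mul _ (by fun_prop)]
  have h1 : ∫⁻ g : Hᗮ, (∫⁻ ω, (delta H (M ω) e)⁻¹ ∂μ) * (ENNReal.ofReal (‖g‖ ^ 2))⁻¹ ∂(gaussK K Hᗮ)
      = ∫⁻ g : Hᗮ, ∫⁻ ω, (delta H (M ω) g)⁻¹ ∂μ ∂(gaussK K Hᗮ) := by
    refine lintegral_congr_ae ?_
    filter_upwards [hne] with g hg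
    rw [hhom g g.2 (by simpa using hg)]
    rfl
  rw [h1, lintegral_lintegral_swap]
  · refine lintegral_congr_ae ?_
    filter_upwards [hM.2.2] with ω hω
    rw [← hrkV]
    refine delta_gauss H (M ω) hω ?_
    rw [hrkV]
    refine hd.trans_le ?_
    gcongr
    exact_mod_cast Submodule.finrank_map_le _ _
  · apply Measurable.aemeasurable
    exact ((delta_meas H).comp ((hM.1.comp measurable_snd).prodMk
      (measurable_subtype_coe.comp measurable_fst))).inv

lemma core_lt_top {K : Type*} [RCLike K] [MeasurableSpace K] [BorelSpace K]
    {Y : Type*} [MeasurableSpace Y] {μ : Measure Y} [IsProbabilityMeasure μ] {n l : ℕ} (hln : l ≤ n)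
    {M : Y → Matrix (Fin n) (Fin l) K} (hM : IsRandomOrthonormal μ M)
    (H : Submodule K (EE K n)) (e : EE K n) (he : e ∈ Hᗮ) (hen : ‖e‖ = 1)
    (hd : 2 < (Module.finrank ℝ K : ℝ) * ((l : ℝ) - Module.finrank K H)) :
    ∀ᵐ ω ∂μ, delta H (M ω) e ≠ 0 := by
  have h := core_eq hln hM H e he hen hd
  have hln' : (l : ℝ) ≤ n := by exact_mod_cast hln
  have hN : 2 < (Module.finrank ℝ K : ℝ) * ((n : ℝ) - Module.finrank K H) := by
    refine hd.trans_le ?_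
    gcongr
  have h2 : ∫⁻ ω, ENNReal.ofReal (1 / ((Module.finrank ℝ K : ℝ) *
      ((l : ℝ) - Module.finrank K (H.map (toEuclideanLin (M ω)ᴴ))) - 2)) ∂μ ≤
      ENNReal.ofReal (1 / ((Module.finrank ℝ K : ℝ) * ((l : ℝ) - Module.finrank K H) - 2)) := by
    refine (lintegral_mono (g := fun _ => ENNReal.ofReal (1 / ((Module.finrank ℝ K : ℝ) *
      ((l : ℝ) - Module.finrank K H) - 2))) fun ω => ?_).trans (by simp)
    refine ENNReal.ofReal_le_ofReal ?_
    have : (0:ℝ) < (Module.finrank ℝ K : ℝ) * ((l : ℝ) - Module.finrank K H) - 2 := by linarith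
    have h3 : (Module.finrank K (H.map (toEuclideanLin (M ω)ᴴ)) : ℝ) ≤ Module.finrank K H := by
      exact_mod_cast Submodule.finrank_map_le _ _
    gcongr
  have hF : ∫⁻ ω, (delta H (M ω) e)⁻¹ ∂μ ≠ ⊤ := by
    intro hF
    rw [hF, ENNReal.top_mul (by simpa using hN)] at h
    rw [← h] at h2
    simp at h2
  have hdm : Measurable fun A : Matrix (Fin n) (Fin l) K => (delta H A e)⁻¹ :=
    ((delta_meas H).comp (measurable_id.prodMk measurable_const)).inv
  filter_upwards [ae_lt_top (hdm.comp hM.1) hF] with ω hω h0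
  simp [h0] at hω

lemma core_val {K : Type*} [RCLike K] [MeasurableSpace K] [BorelSpace K]
    {Y : Type*} [MeasurableSpace Y] {μ : Measure Y} [IsProbabilityMeasure μ] {n l : ℕ} (hln : l ≤ n)
    {M : Y → Matrix (Fin n) (Fin l) K} (hM : IsRandomOrthonormal μ M)
    (H : Submodule K (EE K n)) (e : EE K n) (he : e ∈ Hᗮ) (hen : ‖e‖ = 1)
    (hd : 2 < (Module.finrank ℝ K : ℝ) * ((l : ℝ) - Module.finrank K H))
    (hinj : ∀ᵐ ω ∂μ, Module.finrank K (H.map (toEuclideanLin (M ω)ᴴ)) = Module.finrank K H) :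
    ∫⁻ ω, (delta H (M ω) e)⁻¹ ∂μ =
      ENNReal.ofReal (((Module.finrank ℝ K : ℝ) * ((n : ℝ) - Module.finrank K H) - 2) /
        ((Module.finrank ℝ K : ℝ) * ((l : ℝ) - Module.finrank K H) - 2)) := by
  have h := core_eq hln hM H e he hen hd
  have hln' : (l : ℝ) ≤ n := by exact_mod_cast hln
  have hN : 2 < (Module.finrank ℝ K : ℝ) * ((n : ℝ) - Module.finrank K H) := by
    refine hd.trans_le ?_
    gcongr
  have h2 : ∫⁻ ω, ENNReal.ofReal (1 / ((Module.finrank ℝ K : ℝ) *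
      ((l : ℝ) - Module.finrank K (H.map (toEuclideanLin (M ω)ᴴ))) - 2)) ∂μ =
      ENNReal.ofReal (1 / ((Module.finrank ℝ K : ℝ) * ((l : ℝ) - Module.finrank K H) - 2)) := by
    rw [lintegral_congr_ae (g := fun _ => ENNReal.ofReal (1 / ((Module.finrank ℝ K : ℝ) *
      ((l : ℝ) - Module.finrank K H) - 2)))]
    · simp
    · filter_upwards [hinj] with ω hω
      rw [hω]
  rw [h2] at h
  set a := (Module.finrank ℝ K : ℝ) * ((n : ℝ) - Module.finrank K H) - 2
  set b := (Module.finrank ℝ K : ℝ) * ((l : ℝ) - Module.finrank K H) - 2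
  have ha : 0 < a := by simp only [a]; linarith
  have h3 : ENNReal.ofReal (1 / a) ≠ 0 := by simpa using ha
  rw [← ENNReal.mul_left_inj h3 ENNReal.ofReal_ne_top, h, ← ENNReal.ofReal_mul' (by positivity)]
  congr 1
  field_simp

/-- Standard basis vector. -/
def sb (K : Type*) [RCLike K] {n : ℕ} (j : Fin n) : EE K n := EuclideanSpace.single j 1

/-- Coordinate subspace. -/
def HS (K : Type*) [RCLike K] {n : ℕ} (T : Finset (Fin n)) : Submodule K (EE K n) :=
  Submodule.span K (Set.range fun j : T => sb K (j : Fin n))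

/-- The `j`-th row of `Ω`, conjugated. -/
def rowv {K : Type*} [RCLike K] {n l : ℕ} (Om : Matrix (Fin n) (Fin l) K) (j : Fin n) : EE K l :=
  toEuclideanLin Omᴴ (sb K j)

/-- Gram matrix of the rows in `S`. -/
def Wm {K : Type*} [RCLike K] {n l : ℕ} (S : Finset (Fin n)) (Om : Matrix (Fin n) (Fin l) K) :
    Matrix S S K := Matrix.of fun j k => inner K (rowv Om j) (rowv Om k)

/-- Dual vector. -/
def qv {K : Type*} [RCLike K] {n l : ℕ} (S : Finset (Fin n)) (i : S)
    (Om : Matrix (Fin n) (Fin l) K) : EE K l := ∑ j : S, (Wm S Om)⁻¹ j i • rowv Om j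

/-- `z = Ω q`. -/
def zv {K : Type*} [RCLike K] {n l : ℕ} (S : Finset (Fin n)) (i : S)
    (Om : Matrix (Fin n) (Fin l) K) : EE K n := toEuclideanLin Om (qv S i Om)

section
variable {K : Type*} [RCLike K] {n l : ℕ}

lemma sb_inner (j : Fin n) (x : EE K n) : inner K (sb K j) x = x j := by
  simp [sb, EuclideanSpace.inner_single_left]

lemma HS_mem {T : Finset (Fin n)} {j : Fin n} (h : j ∈ T) : sb K j ∈ HS K T :=
  Submodule.subset_span ⟨⟨j, h⟩, rfl⟩

lemma HS_orth {T : Finset (Fin n)} {x : EE K n} : x ∈ (HS K T)ᗮ ↔ ∀ j ∈ T, x j = 0 := by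
  constructor
  · intro h j hj
    rw [← sb_inner (K := K)]
    exact (Submodule.mem_orthogonal _ _).1 h _ (HS_mem hj)
  · intro h
    rw [Submodule.mem_orthogonal]
    intro u hu
    induction hu using Submodule.span_induction with
    | mem u hu => obtain ⟨j, rfl⟩ := hu; simp [sb_inner, h j j.2]
    | zero => simp
    | add x y _ _ hx hy => rw [inner_add_left, hx, hy, add_zero]
    | smul a x _ hx => rw [inner_smul_left, hx, mul_zero]

lemma HS_finrank (T : Finset (Fin n)) : Module.finrank K (HS K T) = T.card := by
  rw [HS, finrank_span_eq_card]
  · simp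
  · have := ((EuclideanSpace.basisFun (Fin n) K).orthonormal.comp (fun j : T => (j : Fin n))
      Subtype.val_injective).linearIndependent
    have h2 : (fun j : T => sb K (j : Fin n)) =
        (EuclideanSpace.basisFun (Fin n) K) ∘ (fun j : T => (j : Fin n)) := by
      ext j : 1; simp [sb]
    rw [h2]; exact this

lemma norm_sb (j : Fin n) : ‖sb K j‖ = 1 := by simp [sb]

lemma linInd_of_delta {S : Finset (Fin n)} {Om : Matrix (Fin n) (Fin l) K}
    (h : ∀ i ∈ S, delta (HS K (S.erase i)) Om (sb K i) ≠ 0) :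
    LinearIndependent K (fun j : S => rowv Om j) := by
  rw [Fintype.linearIndependent_iff]
  intro v hv i
  by_contra hi
  apply h i i.2
  rw [← nonpos_iff_eq_zero]
  have hmem : (v i)⁻¹ • ∑ j ∈ Finset.univ.erase i, v j • sb K (j : Fin n) ∈ HS K (S.erase i) := by
    refine Submodule.smul_mem _ _ (Submodule.sum_mem _ fun j hj => Submodule.smul_mem _ _ ?_)
    refine HS_mem (Finset.mem_erase.2 ⟨?_, j.2⟩)
    exact fun hji => (Finset.mem_erase.1 hj).1 (Subtype.ext hji)
  refine (iInf_le _ ⟨_, hmem⟩).trans (le_of_eq ?_)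
  have : sb K (i : Fin n) + (v i)⁻¹ • ∑ j ∈ Finset.univ.erase i, v j • sb K (j : Fin n)
      = (v i)⁻¹ • ∑ j, v j • sb K (j : Fin n) := by
    rw [← Finset.add_sum_erase _ _ (Finset.mem_univ i), smul_add, smul_smul,
      inv_mul_cancel₀ hi, one_smul]
  simp only [this, map_smul, map_sum]
  change ENNReal.ofReal (‖(v i)⁻¹ • ∑ j, v j • rowv Om j‖ ^ 2) = 0
  rw [hv]; simp

lemma finrank_map_HS {S T : Finset (Fin n)} (hTS : T ⊆ S) {Om : Matrix (Fin n) (Fin l) K}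
    (h : LinearIndependent K (fun j : S => rowv Om j)) :
    Module.finrank K ((HS K T).map (toEuclideanLin Omᴴ)) = Module.finrank K (HS K T) := by
  rw [HS_finrank, HS, Submodule.map_span, ← Set.range_comp]
  have h2 := h.comp (fun j : T => (⟨j, hTS j.2⟩ : S)) (fun a b hab =>
    Subtype.ext (congrArg (fun x : S => (x : Fin n)) hab))
  have h3 := finrank_span_eq_card h2
  rw [Fintype.card_coe] at h3
  exact h3

lemma Wm_unit {S : Finset (Fin n)} {Om : Matrix (Fin n) (Fin l) K}
    (h : LinearIndependent K (fun j : S => rowv Om j)) : IsUnit (Wm S Om).det := by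
  have := (Matrix.posDef_gram_of_linearIndependent h).isUnit
  rw [Matrix.isUnit_iff_isUnit_det] at this
  exact this

lemma inner_qv {S : Finset (Fin n)} {Om : Matrix (Fin n) (Fin l) K}
    (h : LinearIndependent K (fun j : S => rowv Om j)) (i k : S) :
    inner K (rowv Om k) (qv S i Om) = if k = i then 1 else 0 := by
  have h1 := Matrix.mul_nonsing_inv _ (Wm_unit h)
  have h2 := congrFun (congrFun h1 k) i
  rw [Matrix.mul_apply, Matrix.one_apply] at h2
  rw [← h2, qv, inner_sum]
  refine Finset.sum_congr rfl fun j _ => ?_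
  rw [inner_smul_right, mul_comm]; rfl

lemma zv_apply (S : Finset (Fin n)) (Om : Matrix (Fin n) (Fin l) K) (i : S) (k : Fin n) :
    zv S i Om k = inner K (rowv Om k) (qv S i Om) := by
  rw [rowv, inner_T, sb_inner]; rfl

lemma delta_qv {S : Finset (Fin n)} {Om : Matrix (Fin n) (Fin l) K}
    (h : LinearIndependent K (fun j : S => rowv Om j)) (i : S) :
    (delta (HS K (S.erase i)) Om (sb K (i : Fin n)))⁻¹ = ENNReal.ofReal (‖qv S i Om‖ ^ 2) := by
  set q := qv S i Om with hq
  set c : S → K := fun j => (Wm S Om)⁻¹ j i with hc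
  have hz0 : zv S i Om ∈ (HS K (S.erase i))ᗮ := by
    rw [HS_orth]
    intro j hj
    have hj' := Finset.mem_erase.1 hj
    have := inner_qv h i ⟨j, hj'.2⟩
    rw [zv_apply, this, if_neg]
    simpa [Subtype.ext_iff] using hj'.1
  have hz1 : zv S i Om i = 1 := by rw [zv_apply, inner_qv h i i, if_pos rfl]
  have hin : ∀ x ∈ HS K (S.erase i), inner K (toEuclideanLin Omᴴ (sb K (i : Fin n) + x)) q = 1 := by
    intro x hx
    rw [inner_T, inner_add_left, sb_inner]
    change zv S i Om i + inner K x (zv S i Om) = 1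
    rw [hz1, (Submodule.mem_orthogonal _ _).1 hz0 x hx, add_zero]
  have hq0 : q ≠ 0 := by
    intro h0
    have := hin 0 (Submodule.zero_mem _)
    rw [h0, inner_zero_right] at this
    exact zero_ne_one this
  have hqn : 0 < ‖q‖ := norm_pos_iff.2 hq0
  have hqq : inner K q q = (starRingEnd K) (c i) := by
    conv_lhs => rw [hq]
    conv_lhs => arg 2; rw [qv]
    rw [sum_inner]
    simp_rw [inner_smul_left, inner_qv h]
    simp [hc]
  have hci : c i = ((‖q‖ ^ 2 : ℝ) : K) := by
    rw [← RCLike.conj_conj (c i), ← hqq, inner_self_eq_norm_sq_to_K]; simp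
  have hci0 : c i ≠ 0 := by
    rw [hci]; exact_mod_cast (pow_pos hqn 2).ne'
  have : delta (HS K (S.erase i)) Om (sb K (i : Fin n)) = ENNReal.ofReal ((‖q‖ ^ 2)⁻¹) := by
    apply le_antisymm
    · have hmem : (c i)⁻¹ • ∑ j ∈ Finset.univ.erase i, c j • sb K (j : Fin n) ∈ HS K (S.erase i) := by
        refine Submodule.smul_mem _ _ (Submodule.sum_mem _ fun j hj => Submodule.smul_mem _ _ ?_)
        refine HS_mem (Finset.mem_erase.2 ⟨?_, j.2⟩)
        exact fun hji => (Finset.mem_erase.1 hj).1 (Subtype.ext hji)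
      refine (iInf_le _ ⟨_, hmem⟩).trans (le_of_eq ?_)
      have : sb K (i : Fin n) + (c i)⁻¹ • ∑ j ∈ Finset.univ.erase i, c j • sb K (j : Fin n)
          = (c i)⁻¹ • ∑ j, c j • sb K (j : Fin n) := by
        rw [← Finset.add_sum_erase _ _ (Finset.mem_univ i), smul_add, smul_smul,
          inv_mul_cancel₀ hci0, one_smul]
      simp only [this, map_smul, map_sum]
      change ENNReal.ofReal (‖(c i)⁻¹ • q‖ ^ 2) = _
      rw [norm_smul, norm_inv, hci, RCLike.norm_ofReal, abs_of_nonneg (by positivity)]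
      congr 1
      field_simp
    · refine le_iInf fun x => ENNReal.ofReal_le_ofReal ?_
      have h1 := norm_inner_le_norm (𝕜 := K) (toEuclideanLin Omᴴ (sb K (i : Fin n) + x)) q
      rw [hin x x.2, norm_one] at h1
      rw [inv_le_iff_one_le_mul₀ (by positivity), ← mul_pow]
      exact one_le_pow₀ h1
  rw [this, ← ENNReal.ofReal_inv_of_pos (by positivity), inv_inv]

lemma zv_rot (S : Finset (Fin n)) (i : S) (Om : Matrix (Fin n) (Fin l) K)
    (U : Matrix (Fin n) (Fin n) K) (hU : ∀ x ∈ HS K S, toEuclideanLin Uᴴ x = x) :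
    zv S i (U * Om) = toEuclideanLin U (zv S i Om) := by
  have h1 : ∀ j : S, rowv (U * Om) j = rowv Om j := by
    intro j
    rw [rowv, conjTranspose_mul, toE_mul, hU _ (HS_mem j.2)]; rfl
  have h2 : Wm S (U * Om) = Wm S Om := by
    ext j k; simp [Wm, h1]
  have h3 : qv S i (U * Om) = qv S i Om := by
    simp [qv, h1, h2]
  rw [zv, h3, toE_mul]; rfl


lemma rowv_cont (j : Fin n) : Continuous fun Om : Matrix (Fin n) (Fin l) K => rowv Om j := by
  simp only [rowv, toLpLin_apply]; fun_prop


lemma Wm_cont (S : Finset (Fin n)) : Continuous fun Om : Matrix (Fin n) (Fin l) K => Wm S Om := by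
  refine continuous_matrix fun j k => ?_
  simp only [Wm, of_apply]
  exact Continuous.inner (𝕜 := K) (rowv_cont (j : Fin n)) (rowv_cont (k : Fin n))

variable [MeasurableSpace K] [BorelSpace K]

lemma Wm_inv_meas (S : Finset (Fin n)) (j i : S) :
    Measurable fun Om : Matrix (Fin n) (Fin l) K => (Wm S Om)⁻¹ j i := by
  have h2 := Wm_cont (K := K) (l := l) S
  simp only [Matrix.inv_def, Ring.inverse_eq_inv', Matrix.smul_apply, smul_eq_mul]
  exact (h2.matrix_det.measurable.inv).mul (h2.matrix_adjugate.matrix_elem j i).measurable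

lemma qv_meas (S : Finset (Fin n)) (i : S) :
    Measurable (fun Om : Matrix (Fin n) (Fin l) K => qv S i Om) := by
  unfold qv
  exact Finset.measurable_sum _ fun j _ => (Wm_inv_meas S j i).smul (rowv_cont (j : Fin n)).measurable

lemma zv_meas (S : Finset (Fin n)) (i : S) :
    Measurable (fun Om : Matrix (Fin n) (Fin l) K => zv S i Om) := by
  have h5 : Continuous fun p : Matrix (Fin n) (Fin l) K × EE K l => toEuclideanLin p.1 p.2 := by
    simp only [toLpLin_apply]; fun_prop
  have h6 : Measurable fun Om : Matrix (Fin n) (Fin l) K => (Om, qv S i Om) :=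
    Measurable.prodMk measurable_id (qv_meas S i)
  have h7 := h5.measurable.comp h6
  simp only [Function.comp_def] at h7
  exact h7

end

lemma alphaK_cases (K : Type*) [RCLike K] :
    (alphaK K = 1 ∧ Module.finrank ℝ K = 1) ∨ (alphaK K = 0 ∧ Module.finrank ℝ K = 2) := by
  rcases RCLike.I_eq_zero_or_im_I_eq_one (K := K) with h | h
  · left
    refine ⟨by simp [alphaK, h], ?_⟩
    have e : K ≃ₗ[ℝ] ℝ := (RCLike.realLinearIsometryEquiv h).toLinearEquiv
    rw [e.finrank_eq]; simp
  · right
    have hI : (RCLike.I : K) ≠ 0 := by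
      intro h0; rw [h0] at h; simp at h
    refine ⟨by simp [alphaK, hI], ?_⟩
    have e : K ≃ₗ[ℝ] ℂ := (RCLike.complexLinearIsometryEquiv h).toLinearEquiv
    rw [e.finrank_eq, Complex.finrank_real_complex]

section
variable {K : Type*} [RCLike K] [MeasurableSpace K] [BorelSpace K]
    {Y : Type*} [MeasurableSpace Y] {μ : Measure Y} [IsProbabilityMeasure μ] {n l : ℕ}


lemma hd_aux {S : Finset (Fin n)} (hr : (S.card : ℝ) < (l : ℝ) - alphaK K) {i : Fin n} (hi : i ∈ S) :
    2 < (Module.finrank ℝ K : ℝ) * ((l : ℝ) - Module.finrank K (HS K (S.erase i))) := by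
  rw [HS_finrank, Finset.card_erase_of_mem hi, Nat.cast_sub (Finset.card_pos.2 ⟨i, hi⟩)]
  rcases alphaK_cases K with ⟨h1, h2⟩ | ⟨h1, h2⟩ <;> rw [h1] at hr <;> rw [h2] <;> push_cast <;>
    linarith

lemma sb_orth (S : Finset (Fin n)) (i : Fin n) (hi : i ∉ S) : sb K i ∈ (HS K S)ᗮ := by
  rw [HS_orth]
  intro j hj
  have : j ≠ i := fun h => hi (h ▸ hj)
  simp [sb, this]

lemma ae_linInd (hln : l ≤ n)
    {M : Y → Matrix (Fin n) (Fin l) K} (hM : IsRandomOrthonormal μ M) {S : Finset (Fin n)}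
    (hr : (S.card : ℝ) < (l : ℝ) - alphaK K) :
    ∀ᵐ ω ∂μ, LinearIndependent K (fun j : S => rowv (M ω) j) := by
  have h : ∀ᵐ ω ∂μ, ∀ i : S, delta (HS K (S.erase i)) (M ω) (sb K (i : Fin n)) ≠ 0 := by
    rw [ae_all_iff]
    intro i
    exact core_lt_top hln hM _ _ (sb_orth _ _ (by simp)) (norm_sb _) (hd_aux hr i.2)
  filter_upwards [h] with ω hω
  exact linInd_of_delta fun i hi => hω ⟨i, hi⟩

lemma lint_qv (hln : l ≤ n)
    {M : Y → Matrix (Fin n) (Fin l) K} (hM : IsRandomOrthonormal μ M) {S : Finset (Fin n)}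
    (hr : (S.card : ℝ) < (l : ℝ) - alphaK K) (i : S) :
    ∫⁻ ω, ENNReal.ofReal (‖qv S i (M ω)‖ ^ 2) ∂μ =
      ENNReal.ofReal (((n : ℝ) - S.card - alphaK K) / ((l : ℝ) - S.card - alphaK K)) := by
  have h1 := core_val hln hM _ _ (sb_orth (K := K) (S.erase i) i (by simp)) (norm_sb _)
    (hd_aux hr i.2) (by
      filter_upwards [ae_linInd hln hM hr] with ω hω
      exact finrank_map_HS (Finset.erase_subset _ _) hω)
  rw [lintegral_congr_ae (g := fun ω => (delta (HS K (S.erase i)) (M ω) (sb K (i : Fin n)))⁻¹), h1]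
  · congr 1
    rw [HS_finrank, Finset.card_erase_of_mem i.2, Nat.cast_sub (Finset.one_le_card.2 ⟨(i : Fin n), i.2⟩)]
    rcases alphaK_cases K with ⟨h1, h2⟩ | ⟨h1, h2⟩ <;> rw [h1] at hr ⊢ <;> rw [h2] <;> push_cast
    · congr 1 <;> ring
    · rw [div_eq_div_iff (by linarith) (by linarith)]; ring
  · filter_upwards [ae_linInd hln hM hr] with ω hω
    rw [delta_qv hω]

lemma inner_meas (S : Finset (Fin n)) (i : S) (v : EE K n) :
    Measurable fun Om : Matrix (Fin n) (Fin l) K =>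
      ENNReal.ofReal (‖inner K (zv S i Om) v‖ ^ 2) := by
  have h : Continuous fun x : EE K n => ‖inner K x v‖ ^ 2 := by fun_prop
  exact ENNReal.measurable_ofReal.comp (h.measurable.comp (zv_meas S i))

lemma lint_inner (hln : l ≤ n)
    {M : Y → Matrix (Fin n) (Fin l) K} (hM : IsRandomOrthonormal μ M) {S : Finset (Fin n)}
    (hr : (S.card : ℝ) < (l : ℝ) - alphaK K) (i : S) (v : EE K n) (hv : v ∈ (HS K S)ᗮ) :
    ∫⁻ ω, ENNReal.ofReal (‖inner K (zv S i (M ω)) v‖ ^ 2) ∂μ =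
      ENNReal.ofReal (‖v‖ ^ 2 * (((n : ℝ) - l) / ((l : ℝ) - S.card - alphaK K) /
        ((n : ℝ) - S.card))) := by
  set h : EE K n → ℝ≥0∞ := fun v => ∫⁻ ω, ENNReal.ofReal (‖inner K (zv S i (M ω)) v‖ ^ 2) ∂μ with hh
  have hrot : ∀ u ∈ (HS K S)ᗮ, ∀ e ∈ (HS K S)ᗮ, ‖u‖ = ‖e‖ → h u = h e := by
    intro u hu e he hue
    obtain ⟨U, hU, c, hc, -, h2, h3⟩ := exists_unitary _ u e hu he hue
    simp only [hh]
    rw [← rot_lintegral hM (inner_meas S i u) hU]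
    refine lintegral_congr fun ω => ?_
    have h4 := inner_T Uᴴ (zv S i (M ω)) u
    rw [conjTranspose_conjTranspose] at h4
    rw [zv_rot S i _ U h2, h4, h3, inner_smul_right, norm_mul, hc, one_mul]
  have hk : ∀ k ∉ S, h v = ENNReal.ofReal (‖v‖ ^ 2) * h (sb K k) := by
    intro k hk
    rw [hrot v hv (((‖v‖ : ℝ) : K) • sb K k) (Submodule.smul_mem _ _ (sb_orth S k hk))
      (by rw [norm_smul, norm_sb]; simp)]
    simp only [hh]
    rw [← lintegral_const_mul (f := fun ω => ENNReal.ofReal (‖inner K (zv S i (M ω)) (sb K k)‖ ^ 2)) _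
      ((inner_meas S i _).comp hM.1)]
    refine lintegral_congr fun ω => ?_
    rw [inner_smul_right, norm_mul, mul_pow, RCLike.norm_ofReal, abs_norm,
      ENNReal.ofReal_mul (by positivity)]
  have hsum : ∑ k ∈ Sᶜ, h (sb K k) + 1 =
      ENNReal.ofReal (((n : ℝ) - S.card - alphaK K) / ((l : ℝ) - S.card - alphaK K)) := by
    rw [← lint_qv hln hM hr i]
    simp only [hh]
    rw [← lintegral_finsetSum (f := fun k ω => ENNReal.ofReal (‖inner K (zv S i (M ω)) (sb K k)‖ ^ 2)) _
      (fun k _ => (inner_meas S i _).comp hM.1)]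
    have h1 : (1 : ℝ≥0∞) = ∫⁻ ω, 1 ∂μ := by simp
    conv_lhs => arg 2; rw [h1]
    rw [← lintegral_add_right _ measurable_const]
    refine lintegral_congr_ae ?_
    filter_upwards [hM.2.2, ae_linInd hln hM hr] with ω hω hli
    rw [← norm_Om _ hω, ← ENNReal.ofReal_sum_of_nonneg (fun _ _ => by positivity),
      ← ENNReal.ofReal_one, ← ENNReal.ofReal_add (Finset.sum_nonneg fun _ _ => by positivity)
      zero_le_one]
    congr 1
    change _ = ‖zv S i (M ω)‖ ^ 2
    rw [EuclideanSpace.norm_sq_eq, ← Finset.sum_compl_add_sum S]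
    congr 1
    · refine Finset.sum_congr rfl fun k _ => ?_
      rw [← inner_conj_symm, sb_inner, RCLike.norm_conj]
    · rw [← Finset.sum_coe_sort S (fun k => ‖zv S i (M ω) k‖ ^ 2)]
      simp_rw [zv_apply, inner_qv hli]
      rw [Finset.sum_eq_single i]
      · simp
      · intro b _ hb; simp [hb]
      · simp
  have hln' : (l : ℝ) ≤ n := by exact_mod_cast hln
  have hα : 0 ≤ alphaK K := by rcases alphaK_cases K with ⟨h1, -⟩ | ⟨h1, -⟩ <;> rw [h1]; norm_num
  set ρ := ((n : ℝ) - S.card - alphaK K) / ((l : ℝ) - S.card - alphaK K) with hρ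
  have hb : 0 < (l : ℝ) - S.card - alphaK K := by linarith
  have hρ1 : ρ - 1 = ((n : ℝ) - l) / ((l : ℝ) - S.card - alphaK K) := by
    rw [hρ]; field_simp; ring
  have hsum' : ∑ k ∈ Sᶜ, h (sb K k) = ENNReal.ofReal (ρ - 1) := by
    rw [ENNReal.ofReal_sub _ zero_le_one, ← hsum, ENNReal.ofReal_one,
      ENNReal.add_sub_cancel_right ENNReal.one_ne_top]
  have hcard : ((Sᶜ.card : ℕ) : ℝ) = (n : ℝ) - S.card := by
    rw [Finset.card_compl, Nat.cast_sub (Finset.card_le_univ S)]; simp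
  have hpos : 0 < (n : ℝ) - S.card := by linarith
  have h5 : (Sᶜ.card : ℝ≥0∞) * h v = ENNReal.ofReal (‖v‖ ^ 2 * (ρ - 1)) := by
    rw [ENNReal.ofReal_mul (by positivity), ← hsum', Finset.mul_sum,
      ← Finset.sum_congr rfl (fun k hk' => hk k (Finset.mem_compl.1 hk')), Finset.sum_const,
      nsmul_eq_mul]
  change h v = _
  rw [← hρ1]
  have hc0 : (Sᶜ.card : ℝ≥0∞) ≠ 0 := by
    intro h0
    have : Sᶜ.card = 0 := by exact_mod_cast h0
    rw [this] at hcard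
    simp at hcard; linarith
  rw [← ENNReal.mul_right_inj hc0 (ENNReal.natCast_ne_top _), h5, ← ENNReal.ofReal_natCast,
    ← ENNReal.ofReal_mul (by positivity), hcard]
  congr 1
  field_simp

lemma int_inner (hln : l ≤ n)
    {M : Y → Matrix (Fin n) (Fin l) K} (hM : IsRandomOrthonormal μ M) {S : Finset (Fin n)}
    (hr : (S.card : ℝ) < (l : ℝ) - alphaK K) (i : S) (v : EE K n) (hv : v ∈ (HS K S)ᗮ) :
    Integrable (fun ω => ‖inner K (zv S i (M ω)) v‖ ^ 2) μ ∧
    ∫ ω, ‖inner K (zv S i (M ω)) v‖ ^ 2 ∂μ =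
      ‖v‖ ^ 2 * (((n : ℝ) - l) / ((l : ℝ) - S.card - alphaK K) / ((n : ℝ) - S.card)) := by
  have h := lint_inner hln hM hr i v hv
  have hm : AEStronglyMeasurable (fun ω => ‖inner K (zv S i (M ω)) v‖ ^ 2) μ := by
    have h : Continuous fun x : EE K n => ‖inner K x v‖ ^ 2 := by fun_prop
    exact (h.measurable.comp ((zv_meas S i).comp hM.1)).aestronglyMeasurable
  have hln' : (l : ℝ) ≤ n := by exact_mod_cast hln
  have hα : 0 ≤ alphaK K := by rcases alphaK_cases K with ⟨h1, -⟩ | ⟨h1, -⟩ <;> rw [h1]; norm_num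
  have hb : 0 < (l : ℝ) - S.card - alphaK K := by linarith
  have hpos : 0 < (n : ℝ) - S.card := by linarith
  have hn : 0 ≤ (n : ℝ) - l := by linarith
  constructor
  · refine ⟨hm, ?_⟩
    rw [hasFiniteIntegral_iff_ofReal (ae_of_all _ fun _ => by positivity), h]
    exact ENNReal.ofReal_lt_top
  · rw [integral_eq_lintegral_of_nonneg_ae (ae_of_all _ fun _ => by positivity) hm, h,
      ENNReal.toReal_ofReal (by positivity)]

end

/-- Column of `B` with the rows in `S` set to zero. -/
def bperp {K : Type*} [RCLike K] {n p : ℕ} (S : Finset (Fin n)) (B : Matrix (Fin n) (Fin p) K)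
    (c : Fin p) : EE K n := WithLp.toLp 2 fun k => if k ∈ S then 0 else B k c

lemma bperp_apply {K : Type*} [RCLike K] {n p : ℕ} (S : Finset (Fin n))
    (B : Matrix (Fin n) (Fin p) K) (c : Fin p) (k : Fin n) :
    bperp S B c k = if k ∈ S then 0 else B k c := rfl

lemma bperp_mem {K : Type*} [RCLike K] {n p : ℕ} (S : Finset (Fin n))
    (B : Matrix (Fin n) (Fin p) K) (c : Fin p) : bperp S B c ∈ (HS K S)ᗮ := by
  rw [HS_orth]; intro j hj; simp [bperp_apply, hj]

lemma bperp_norm {K : Type*} [RCLike K] {n p : ℕ} (S : Finset (Fin n))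
    (B : Matrix (Fin n) (Fin p) K) :
    ∑ c, ‖bperp S B c‖ ^ 2 = ∑ k ∈ Sᶜ, ∑ c, ‖B k c‖ ^ 2 := by
  rw [Finset.sum_comm]
  refine Finset.sum_congr rfl fun c _ => ?_
  rw [EuclideanSpace.norm_sq_eq, ← Finset.sum_compl_add_sum S]
  rw [Finset.sum_eq_zero (s := S) (fun k hk => by simp [bperp_apply, hk]), add_zero]
  exact Finset.sum_congr rfl fun k hk => by simp [bperp_apply, Finset.mem_compl.1 hk]

lemma resid {K : Type*} [RCLike K] {n l : ℕ} {S : Finset (Fin n)}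
    {Om : Matrix (Fin n) (Fin l) K} (hli : LinearIndependent K (fun j : S => rowv Om j))
    (x v : EE K n) (hx : ∀ j ∈ S, toEuclideanLin Om (toEuclideanLin Omᴴ x) j = 0)
    (hv : ∀ k ∈ S, v k = 0) (hxv : ∀ k ∉ S, x k + v k = 0) (i : S) :
    x i = inner K (zv S i Om) v := by
  have h1 : inner K (zv S i Om) x = 0 := by
    have h0 := inner_T Omᴴ (qv S i Om) x
    rw [conjTranspose_conjTranspose] at h0
    rw [zv, h0, qv, sum_inner]
    refine Finset.sum_eq_zero fun j _ => ?_
    rw [inner_smul_left, rowv, inner_T, sb_inner, hx j j.2, mul_zero]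
  have h2 : inner K (zv S i Om) (x + v) = x i := by
    rw [PiLp.inner_apply, ← Finset.sum_compl_add_sum S]
    rw [Finset.sum_eq_zero (s := Sᶜ) (fun k hk => by
      rw [PiLp.add_apply, hxv k (Finset.mem_compl.1 hk), inner_zero_right]), zero_add,
      ← Finset.sum_coe_sort S (fun k => inner K (zv S i Om k) ((x + v) k))]
    simp_rw [zv_apply, inner_qv hli]
    rw [Finset.sum_eq_single i]
    · simp [hv i i.2]
    · intro b _ hb; simp [hb]
    · simp
  rw [← h2, inner_add_right, h1, zero_add]

section
variable {K : Type*} [RCLike K] {n d p : ℕ}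

lemma zero_rows {A : Matrix (Fin n) (Fin d) K} {lam : Fin n → K} (hA : A * Aᴴ = diagonal lam)
    (k : Fin n) (hk : lam k = 0) (j : Fin d) : A k j = 0 := by
  have h := congrFun (congrFun hA k) k
  rw [diagonal_apply_eq, hk, Matrix.mul_apply] at h
  have h2 : ∀ j, A k j * Aᴴ j k = ((‖A k j‖ ^ 2 : ℝ) : K) := by
    intro j
    rw [conjTranspose_apply, RCLike.star_def, RCLike.mul_conj]; push_cast; rfl
  simp_rw [h2] at h
  rw [← RCLike.ofReal_sum, RCLike.ofReal_eq_zero,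
    Finset.sum_eq_zero_iff_of_nonneg (fun _ _ => by positivity)] at h
  have h3 := h j (Finset.mem_univ _)
  simpa using h3

lemma inf_diag {A : Matrix (Fin n) (Fin d) K} {lam : Fin n → K} (hA : A * Aᴴ = diagonal lam)
    (B : Matrix (Fin n) (Fin p) K) (S : Finset (Fin n)) (hS : ∀ k, k ∈ S ↔ lam k ≠ 0) :
    ⨅ X : Matrix (Fin d) (Fin p) K, frobSq (B - A * X) = ∑ k ∈ Sᶜ, ∑ c, ‖B k c‖ ^ 2 := by
  have hz : ∀ (X : Matrix (Fin d) (Fin p) K), ∀ k ∉ S, ∀ c, (B - A * X) k c = B k c := by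
    intro X k hk c
    have hk0 : lam k = 0 := by by_contra h; exact hk ((hS k).2 h)
    rw [Matrix.sub_apply, Matrix.mul_apply,
      Finset.sum_eq_zero (fun j _ => by rw [zero_rows hA k hk0 j, zero_mul]), sub_zero]
  have hsplit : ∀ X : Matrix (Fin d) (Fin p) K, frobSq (B - A * X) =
      ∑ k ∈ Sᶜ, ∑ c, ‖B k c‖ ^ 2 + ∑ k ∈ S, ∑ c, ‖(B - A * X) k c‖ ^ 2 := by
    intro X
    rw [frobSq, ← Finset.sum_compl_add_sum S]
    congr 1
    refine Finset.sum_congr rfl fun k hk => Finset.sum_congr rfl fun c _ => ?_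
    rw [hz X k (Finset.mem_compl.1 hk)]
  apply le_antisymm
  · refine (ciInf_le ⟨0, ?_⟩ (Aᴴ * (diagonal (fun k => (lam k)⁻¹) * B))).trans (le_of_eq ?_)
    · rintro _ ⟨X, rfl⟩
      exact Finset.sum_nonneg fun _ _ => Finset.sum_nonneg fun _ _ => by positivity
    · rw [hsplit, Finset.sum_eq_zero (s := S), add_zero]
      intro k hk
      refine Finset.sum_eq_zero fun c _ => ?_
      rw [← Matrix.mul_assoc, hA, Matrix.sub_apply, diagonal_mul, diagonal_mul,
        mul_inv_cancel_left₀ ((hS k).1 hk)]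
      simp
  · refine le_ciInf fun X => ?_
    rw [hsplit]
    exact le_add_of_nonneg_right
      (Finset.sum_nonneg fun _ _ => Finset.sum_nonneg fun _ _ => by positivity)

lemma normal_eq {l : ℕ} {A : Matrix (Fin n) (Fin d) K} {lam : Fin n → K}
    (hA : A * Aᴴ = diagonal lam) (B : Matrix (Fin n) (Fin p) K) (Om : Matrix (Fin n) (Fin l) K)
    (G : Matrix (Fin d) (Fin l) K) (hG : IsMoorePenrose (Omᴴ * A) G) (k : Fin n) (hk : lam k ≠ 0)
    (c : Fin p) :
    (Om * (Omᴴ * (A * (G * (Omᴴ * B)) - B))) k c = 0 := by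
  obtain ⟨h1, -, h3, -⟩ := hG
  have h4 : (Omᴴ * A)ᴴ * (Omᴴ * A * G) = (Omᴴ * A)ᴴ := by
    have := congrArg conjTranspose h1
    rwa [conjTranspose_mul, h3] at this
  have h5 : Aᴴ * (Om * (Omᴴ * (A * (G * (Omᴴ * B)) - B))) = 0 := by
    rw [conjTranspose_mul, conjTranspose_conjTranspose] at h4
    have h6 := congrArg (fun X => X * (Omᴴ * B)) h4
    simp only [Matrix.mul_assoc] at h6
    simp only [Matrix.mul_sub, h6, sub_self]
  have h7 := congrArg (fun X => A * X) h5
  simp only [Matrix.mul_zero] at h7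
  rw [← Matrix.mul_assoc, hA] at h7
  have h8 := congrFun (congrFun h7 k) c
  rw [diagonal_mul] at h8
  simpa [hk] using h8

variable [MeasurableSpace K] [BorelSpace K] {Y : Type*} [MeasurableSpace Y]
  {μ : Measure Y} [IsProbabilityMeasure μ] {l : ℕ}

lemma frob_formula {A : Matrix (Fin n) (Fin d) K} {lam : Fin n → K}
    (hA : A * Aᴴ = diagonal lam) (B : Matrix (Fin n) (Fin p) K) (Om : Matrix (Fin n) (Fin l) K)
    (G : Matrix (Fin d) (Fin l) K) (hG : IsMoorePenrose (Omᴴ * A) G)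
    (S : Finset (Fin n)) (hS : ∀ k, k ∈ S ↔ lam k ≠ 0)
    (hli : LinearIndependent K (fun j : S => rowv Om j)) :
    frobSq (B - A * (G * (Omᴴ * B))) = ∑ k ∈ Sᶜ, ∑ c, ‖B k c‖ ^ 2 +
      ∑ i : S, ∑ c, ‖inner K (zv S i Om) (bperp S B c)‖ ^ 2 := by
  set Yh := A * (G * (Omᴴ * B)) with hY
  have hY0 : ∀ k ∉ S, ∀ c, Yh k c = 0 := by
    intro k hk c
    have hk0 : lam k = 0 := by by_contra h; exact hk ((hS k).2 h)
    rw [hY, Matrix.mul_apply,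
      Finset.sum_eq_zero (fun j _ => by rw [zero_rows hA k hk0 j, zero_mul])]
  rw [frobSq, ← Finset.sum_compl_add_sum S]
  congr 1
  · refine Finset.sum_congr rfl fun k hk => Finset.sum_congr rfl fun c _ => ?_
    rw [Matrix.sub_apply, hY0 k (Finset.mem_compl.1 hk), sub_zero]
  · rw [← Finset.sum_coe_sort S (fun k => ∑ c, ‖(B - Yh) k c‖ ^ 2)]
    refine Finset.sum_congr rfl fun i _ => Finset.sum_congr rfl fun c _ => ?_
    have h := resid hli (WithLp.toLp 2 fun k => (Yh - B) k c) (bperp S B c) ?_ ?_ ?_ i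
    · rw [← h]
      change _ = ‖(Yh - B) i c‖ ^ 2
      rw [Matrix.sub_apply, Matrix.sub_apply, norm_sub_rev]
    · intro j hj
      have := normal_eq hA B Om G hG j ((hS j).1 hj) c
      rw [← this]
      rfl
    · intro k hk; simp [bperp_apply, hk]
    · intro k hk
      rw [bperp_apply, if_neg hk]
      change (Yh - B) k c + B k c = 0
      rw [Matrix.sub_apply, hY0 k hk]; ring

lemma diag_case (hln : l ≤ n) {M : Y → Matrix (Fin n) (Fin l) K} (hM : IsRandomOrthonormal μ M)
    {A : Matrix (Fin n) (Fin d) K} {lam : Fin n → K}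
    (hA : A * Aᴴ = diagonal lam) (B : Matrix (Fin n) (Fin p) K)
    (G : Matrix (Fin l) (Fin d) K → Matrix (Fin d) (Fin l) K) (hG : ∀ X, IsMoorePenrose X (G X))
    (S : Finset (Fin n)) (hS : ∀ k, k ∈ S ↔ lam k ≠ 0)
    (hr : (S.card : ℝ) < (l : ℝ) - alphaK K) :
    ∫ ω, frobSq (B - A * (G ((M ω)ᴴ * A) * ((M ω)ᴴ * B))) ∂μ
      = (1 + ((n : ℝ) - (l : ℝ)) / ((n : ℝ) - (S.card : ℝ)) *
          ((S.card : ℝ) / ((l : ℝ) - (S.card : ℝ) - alphaK K))) *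
        ⨅ X : Matrix (Fin d) (Fin p) K, frobSq (B - A * X) := by
  have hI := fun (i : S) (c : Fin p) => int_inner hln hM hr i _ (bperp_mem S B c)
  rw [inf_diag hA B S hS, integral_congr_ae (g := fun ω => ∑ k ∈ Sᶜ, ∑ c, ‖B k c‖ ^ 2 +
      ∑ i : S, ∑ c, ‖inner K (zv S i (M ω)) (bperp S B c)‖ ^ 2)]
  · rw [integral_add (integrable_const _)
      (integrable_finsetSum _ fun i _ => integrable_finsetSum _ fun c _ => (hI i c).1),
      integral_finsetSum _ (fun i _ => integrable_finsetSum _ fun c _ => (hI i c).1)]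
    simp_rw [fun i : S => integral_finsetSum Finset.univ (fun c _ => (hI i c).1), (hI _ _).2]
    rw [integral_const]
    simp_rw [← Finset.sum_mul, bperp_norm]
    simp
    ring
  · filter_upwards [ae_linInd hln hM hr] with ω hω
    exact frob_formula hA B _ _ (hG _) S hS hω

end

lemma frobSq_unitary {K : Type*} [RCLike K] {n p : ℕ} (U : Matrix (Fin n) (Fin n) K)
    (hU : Uᴴ * U = 1) (N : Matrix (Fin n) (Fin p) K) : frobSq (U * N) = frobSq N := by
  unfold frobSq
  rw [Finset.sum_comm, Finset.sum_comm (f := fun i j => ‖N i j‖ ^ 2)]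
  refine Finset.sum_congr rfl fun c _ => ?_
  have h := norm_Om U hU (WithLp.toLp 2 fun k => N k c)
  have h2 := congrArg (fun x => x ^ 2) h
  simp only [EuclideanSpace.norm_sq_eq] at h2
  exact h2

lemma iro_unitary {K : Type*} [RCLike K] [MeasurableSpace K] [BorelSpace K] {Y : Type*}
    [MeasurableSpace Y] {μ : Measure Y} {n l : ℕ} {M : Y → Matrix (Fin n) (Fin l) K}
    (hM : IsRandomOrthonormal μ M) {V : Matrix (Fin n) (Fin n) K}
    (hV : V ∈ Matrix.unitaryGroup (Fin n) K) : IsRandomOrthonormal μ (fun ω => V * M ω) := by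
  refine ⟨?_, ?_, ?_⟩
  · have h : Continuous fun X : Matrix (Fin n) (Fin l) K => V * X := by fun_prop
    exact h.measurable.comp hM.1
  · intro W hW
    have h := hM.2.1 (W * V) (mul_mem hW hV)
    rw [hM.2.1 V hV, ← h]
    simp only [Matrix.mul_assoc]
  · filter_upwards [hM.2.2] with ω hω
    have hV2 : Vᴴ * V = 1 := Matrix.mem_unitaryGroup_iff'.1 hV
    rw [conjTranspose_mul, Matrix.mul_assoc, ← Matrix.mul_assoc Vᴴ, hV2, Matrix.one_mul, hω]

/-- **Sketch-and-solve, exact analysis for random orthonormal embeddings** (Theorem 2.1):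
`E‖B − AX̂‖_F² = (1 + ((n − ℓ)/(n − r)) · r/(ℓ − r − α_K)) · min_X ‖B − AX‖_F²`. -/
theorem sketch_and_solve_orthonormal
    {K : Type*} [RCLike K] [MeasurableSpace K] [BorelSpace K]
    {Y : Type*} [MeasurableSpace Y] (μ : Measure Y) [IsProbabilityMeasure μ]
    (pinv : (m n : ℕ) → Matrix (Fin m) (Fin n) K → Matrix (Fin n) (Fin m) K)
    (hpinv : ∀ (m n : ℕ) (A : Matrix (Fin m) (Fin n) K), IsMoorePenrose A (pinv m n A))
    (n ℓ d p : ℕ) (hℓn : ℓ ≤ n)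
    (M : Y → Matrix (Fin n) (Fin ℓ) K)
    (hM : IsRandomOrthonormal μ M)
    (A : Matrix (Fin n) (Fin d) K) (B : Matrix (Fin n) (Fin p) K)
    (hrank : (A.rank : ℝ) < (ℓ : ℝ) - alphaK K) :
    ∫ ω, frobSq (B - A * (pinv ℓ d ((M ω)ᴴ * A) * ((M ω)ᴴ * B))) ∂μ
      = (1 + ((n : ℝ) - (ℓ : ℝ)) / ((n : ℝ) - (A.rank : ℝ)) *
          ((A.rank : ℝ) / ((ℓ : ℝ) - (A.rank : ℝ) - alphaK K))) *
        ⨅ X : Matrix (Fin d) (Fin p) K, frobSq (B - A * X) := by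
  classical
  have hH : (A * Aᴴ).IsHermitian := Matrix.isHermitian_mul_conjTranspose_self A
  obtain ⟨V, hV, lam, hd, hcard⟩ : ∃ V ∈ Matrix.unitaryGroup (Fin n) K, ∃ lam : Fin n → K,
      V * (A * Aᴴ) * Vᴴ = diagonal lam ∧
      (Finset.univ.filter fun k => lam k ≠ 0).card = A.rank := by
    refine ⟨star (hH.eigenvectorUnitary : Matrix (Fin n) (Fin n) K),
      (star hH.eigenvectorUnitary).2, fun k => (hH.eigenvalues k : K), ?_, ?_⟩
    · have h := hH.conjStarAlgAut_star_eigenvectorUnitary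
      rw [Unitary.conjStarAlgAut_star_apply] at h
      rw [← star_eq_conjTranspose, star_star]
      exact h
    · rw [← rank_self_mul_conjTranspose A, hH.rank_eq_card_non_zero_eigs, Fintype.card_subtype]
      simp
  have hV1 : Vᴴ * V = 1 := Matrix.mem_unitaryGroup_iff'.1 hV
  have hA : (V * A) * (V * A)ᴴ = diagonal lam := by
    rw [← hd, conjTranspose_mul]; simp only [Matrix.mul_assoc]
  have key := diag_case hℓn (iro_unitary hM hV) hA (V * B) (pinv ℓ d) (hpinv ℓ d)
    (Finset.univ.filter fun k => lam k ≠ 0) (by simp) (by rw [hcard]; exact hrank)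
  have hc : ∀ {q : ℕ} (ω : Y) (N : Matrix (Fin n) (Fin q) K),
      (V * M ω)ᴴ * (V * N) = (M ω)ᴴ * N := by
    intro q ω N
    rw [conjTranspose_mul, Matrix.mul_assoc, ← Matrix.mul_assoc Vᴴ, hV1, Matrix.one_mul]
  have hf : ∀ X : Matrix (Fin d) (Fin p) K, frobSq (V * B - V * A * X) = frobSq (B - A * X) := by
    intro X
    rw [Matrix.mul_assoc, ← Matrix.mul_sub, frobSq_unitary V hV1]
  simp only [hc, hf, hcard] at key
  exact key
end
end

section
/- Let Ω ∈ K^{n×ℓ} be any random embedding that has full column rank almost surely. For any problem dimensions d, p ∈ ℕ and any rank parameter r ∈ ℕ with r ≤ ℓ − α_K, the supremum over all matrices A ∈ K^{n×d} with rank(A) = r and all B ∈ K^{n×p} with B − AA⁺B ≠ 0 of the ratio E‖B − A(Ω*A)⁺(Ω*B)‖_F² / ‖B − AA⁺B‖_F² is at least 1 + ((n − ℓ)/(n − r)) · r/(ℓ − r − α_K). -/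
open MeasureTheory ProbabilityTheory Matrix Filter
open scoped ENNReal Topology ComplexOrder

noncomputable section

section alg
variable {K : Type*} [RCLike K]

/-- Squared Euclidean norm. -/
def nsq {ι : Type*} [Fintype ι] (x : ι → K) : ℝ := ∑ i, ‖x i‖ ^ 2

lemma nsq_eq {ι : Type*} [Fintype ι] (x : ι → K) : ((nsq x : ℝ) : K) = star x ⬝ᵥ x := by
  simp [nsq, dotProduct, RCLike.conj_mul]

lemma nsq_mulVec {ι τ : Type*} [Fintype ι] [Fintype τ] [DecidableEq τ] (Q : Matrix ι τ K)
    (hQ : Qᴴ * Q = 1) (x : τ → K) : nsq (Q *ᵥ x) = nsq x := by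
  have : ((nsq (Q *ᵥ x) : ℝ) : K) = (nsq x : ℝ) := by
    rw [nsq_eq, nsq_eq, star_mulVec, ← dotProduct_mulVec, mulVec_mulVec, hQ, one_mulVec]
  exact_mod_cast this

end alg

section gauss
variable {K : Type*} [RCLike K] [MeasurableSpace K] [BorelSpace K]

variable (K) in
/-- Standard Gaussian measure on `ι → K`. -/
def gam (ι : Type*) [Fintype ι] : Measure (ι → K) := Measure.pi (fun _ => stdGaussian K)

instance gam_prob (ι : Type*) [Fintype ι] : IsProbabilityMeasure (gam K ι) := by
  unfold gam; infer_instance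

lemma charFun_gam {ι : Type*} [Fintype ι] (t : EuclideanSpace K ι) :
    charFun ((gam K ι).map (WithLp.toLp 2)) t = Complex.exp (-(nsq (fun i => t i) : ℝ) / 2) := by
  unfold gam
  rw [charFun_pi]
  simp_rw [charFun_stdGaussian]
  rw [← Complex.exp_sum]
  simp [nsq, Finset.sum_div, Finset.sum_neg_distrib, neg_div]

lemma gam_map {ι τ : Type*} [Fintype ι] [Fintype τ] [DecidableEq τ] (Q : Matrix ι τ K)
    (hQ : Qᴴ * Q = 1) : MeasurePreserving (fun x => Qᴴ *ᵥ x) (gam K ι) (gam K τ) := by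
  have hm : Measurable (fun x : ι → K => Qᴴ *ᵥ x) := by
    apply Continuous.measurable; fun_prop
  refine ⟨hm, ?_⟩
  have hinj : ∀ (μ ν : Measure (τ → K)),
      μ.map (MeasurableEquiv.toLp 2 _) = ν.map (MeasurableEquiv.toLp 2 _) → μ = ν := by
    intro μ ν h
    exact (MeasurableEquiv.map_measurableEquiv_injective _) h
  apply hinj
  apply Measure.ext_of_charFun (E := EuclideanSpace K τ)
  ext t
  have h1 := charFun_gam (K := K) t
  have h2 := charFun_gam (K := K) (WithLp.toLp 2 (Q *ᵥ (fun i => t i)) : EuclideanSpace K ι)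
  have h3 : nsq (fun i => (WithLp.toLp 2 (Q *ᵥ (fun i => t i)) : EuclideanSpace K ι) i)
     = nsq (fun i => t i) := nsq_mulVec Q hQ _
  rw [h3] at h2
  rw [MeasurableEquiv.coe_toLp, h1, ← h2]
  rw [charFun_apply, charFun_apply, ← MeasurableEquiv.coe_toLp, ← MeasurableEquiv.coe_toLp,
    integral_map_equiv, integral_map_equiv, integral_map hm.aemeasurable]
  · congr 1
    ext x
    congr 3
    simp only [MeasurableEquiv.coe_toLp, PiLp.inner_apply, real_inner_eq_re_inner K,
      RCLike.inner_apply]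
    rw [← map_sum, ← map_sum]
    congr 1
    have := dotProduct_mulVec (star x) Q (fun i => t i)
    have h4 : star x ᵥ* Q = star (Qᴴ *ᵥ x) := by simp [star_mulVec]
    rw [h4] at this
    simp only [dotProduct, Pi.star_apply, RCLike.star_def] at this
    simp_rw [mul_comm (t _), mul_comm ((Q *ᵥ fun i => t i) _)]
    exact this.symm
  · apply Continuous.aestronglyMeasurable
    simp only [MeasurableEquiv.coe_toLp]
    fun_prop

end gauss

section laplace
variable {K : Type*} [RCLike K] [MeasurableSpace K] [BorelSpace K]

lemma integral_exp_gaussianReal (t : ℝ) (ht : 0 ≤ t) :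
    ∫ x, Real.exp (-t * x ^ 2) ∂(gaussianReal 0 1) = (1 + 2 * t) ^ (-(1 / 2) : ℝ) := by
  rw [integral_gaussianReal_eq_integral_smul (by norm_num)]
  simp only [gaussianPDFReal, smul_eq_mul, NNReal.coe_one, sub_zero, mul_one]
  have : ∀ x : ℝ, (√(2 * Real.pi))⁻¹ * Real.exp (-x ^ 2 / 2) * Real.exp (-t * x ^ 2)
      = (√(2 * Real.pi))⁻¹ * Real.exp (-(1 / 2 + t) * x ^ 2) := by
    intro x; rw [mul_assoc, ← Real.exp_add]; congr 2; ring
  simp_rw [this]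
  rw [integral_const_mul, integral_gaussian, Real.rpow_neg (by positivity), ← Real.sqrt_eq_rpow,
    ← Real.sqrt_inv, ← Real.sqrt_inv, ← Real.sqrt_mul (by positivity)]
  congr 1
  have := Real.pi_pos
  field_simp

lemma integral_exp_K (t : ℝ) (ht : 0 ≤ t) :
    ∫ x, Real.exp (-t * ‖x‖ ^ 2) ∂(stdGaussian K) =
      (1 + 2 * t) ^ (-(Module.finrank ℝ K / 2) : ℝ) := by
  rw [stdGaussian, integral_map (Measurable.aemeasurable (by fun_prop))
    (Measurable.aestronglyMeasurable (by fun_prop))]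
  have h : ∀ x : Fin (Module.finrank ℝ K) → ℝ,
      Real.exp (-t * ‖∑ i, x i • stdOrthonormalBasis ℝ K i‖ ^ 2)
      = ∏ i, Real.exp (-t * (x i) ^ 2) := by
    intro x
    rw [← Real.exp_sum, ← Finset.mul_sum]
    congr 2
    have := (stdOrthonormalBasis ℝ K).sum_sq_norm_inner_right
      (∑ i, x i • stdOrthonormalBasis ℝ K i)
    rw [← this]
    refine Finset.sum_congr rfl fun i _ => ?_
    simp [inner_sum, inner_smul_right, (stdOrthonormalBasis ℝ K).inner_eq_ite]
  simp_rw [h]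
  rw [integral_fintype_prod_eq_prod (f := fun _ x => Real.exp (-t * x ^ 2))]
  simp_rw [integral_exp_gaussianReal t ht]
  rw [Finset.prod_const, ← Real.rpow_natCast, ← Real.rpow_mul (by positivity)]
  congr 1
  simp
  ring

lemma lintegral_exp_gam (ι : Type*) [Fintype ι] (t : ℝ) (ht : 0 ≤ t) :
    ∫⁻ x, ENNReal.ofReal (Real.exp (-t * nsq x)) ∂(gam K ι) =
      ENNReal.ofReal ((1 + 2 * t) ^ (-(Module.finrank ℝ K * Fintype.card ι / 2) : ℝ)) := by
  have hmeas : Measurable (fun x : ι → K => Real.exp (-t * nsq x)) := by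
    unfold nsq; fun_prop
  rw [← ofReal_integral_eq_lintegral_ofReal]
  · congr 1
    have : ∀ x : ι → K, Real.exp (-t * nsq x) = ∏ i, Real.exp (-t * ‖x i‖ ^ 2) := by
      intro x; rw [← Real.exp_sum, ← Finset.mul_sum]; rfl
    simp_rw [this]
    unfold gam
    rw [integral_fintype_prod_eq_prod (f := fun _ (x : K) => Real.exp (-t * ‖x‖ ^ 2))]
    simp_rw [integral_exp_K t ht]
    rw [Finset.prod_const, ← Real.rpow_natCast, ← Real.rpow_mul (by positivity)]
    congr 1
    simp
    ring
  · refine Integrable.of_bound hmeas.aestronglyMeasurable 1 (ae_of_all _ fun x => ?_)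
    rw [Real.norm_eq_abs, abs_of_pos (Real.exp_pos _), Real.exp_le_one_iff]
    have : 0 ≤ nsq x := by unfold nsq; positivity
    nlinarith
  · exact ae_of_all _ fun x => (Real.exp_pos _).le

lemma gam_ne_zero (ι : Type*) [Fintype ι] [Nonempty ι] : ∀ᵐ x ∂(gam K ι), nsq x ≠ 0 := by
  have hms : MeasurableSet {x : ι → K | nsq x = 0} := by
    apply measurableSet_eq_fun _ measurable_const
    unfold nsq; fun_prop
  rw [ae_iff]
  simp only [not_not]
  have hb : (0 : ℝ) < Module.finrank ℝ K * Fintype.card ι / 2 := by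
    have : 0 < Module.finrank ℝ K := Module.finrank_pos
    have : 0 < Fintype.card ι := Fintype.card_pos
    positivity
  have key : ∀ m : ℕ, gam K ι {x : ι → K | nsq x = 0} ≤
      ENNReal.ofReal ((1 + 2 * (m : ℝ)) ^ (-(Module.finrank ℝ K * Fintype.card ι / 2) : ℝ)) := by
    intro m
    rw [← lintegral_exp_gam ι (m : ℝ) (by positivity), ← lintegral_indicator_one hms]
    refine lintegral_mono fun x => ?_
    by_cases hx : nsq x = 0 <;> simp [Set.indicator, hx]
  have ht : Tendsto (fun m : ℕ => ENNReal.ofReal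
      ((1 + 2 * (m : ℝ)) ^ (-(Module.finrank ℝ K * Fintype.card ι / 2) : ℝ))) atTop (𝓝 0) := by
    rw [← ENNReal.ofReal_zero]
    refine ENNReal.tendsto_ofReal ?_
    refine (tendsto_rpow_neg_atTop hb).comp ?_
    refine tendsto_atTop_mono (fun m => ?_) tendsto_natCast_atTop_atTop
    have : (0 : ℝ) ≤ m := by positivity
    linarith
  exact le_antisymm (ge_of_tendsto' ht key) zero_le

lemma lintegral_inv_gam (ι : Type*) [Fintype ι]
    (hk : (2 : ℝ) < Module.finrank ℝ K * Fintype.card ι) :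
    ENNReal.ofReal (1 / (Module.finrank ℝ K * Fintype.card ι - 2)) ≤
    ∫⁻ x, ENNReal.ofReal (1 / nsq x) ∂(gam K ι) := by
  have hne : Nonempty ι := by
    by_contra h
    rw [not_nonempty_iff] at h
    simp at hk
    linarith
  set b : ℝ := Module.finrank ℝ K * Fintype.card ι with hb
  have e1 : ∫⁻ x, ENNReal.ofReal (1 / nsq x) ∂(gam K ι) =
      ∫⁻ x, (∫⁻ t in Set.Ioi (0 : ℝ), ENNReal.ofReal (Real.exp (-t * nsq x))) ∂(gam K ι) := by
    refine lintegral_congr_ae ?_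
    filter_upwards [gam_ne_zero (K := K) ι] with x hx
    have hpos : 0 < nsq x := lt_of_le_of_ne (by unfold nsq; positivity) (Ne.symm hx)
    have h1 : ∀ t : ℝ, -t * nsq x = (-nsq x) * t := fun t => by ring
    simp_rw [h1]
    rw [← ofReal_integral_eq_lintegral_ofReal]
    · rw [integral_exp_mul_Ioi (by linarith)]
      simp
    · exact integrableOn_exp_mul_Ioi (by linarith) 0
    · exact ae_of_all _ fun x => (Real.exp_pos _).le
  rw [e1, lintegral_lintegral_swap]
  swap
  · apply Measurable.aemeasurable
    unfold nsq Function.uncurry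
    fun_prop
  have e2 : ∫⁻ t in Set.Ioi (0 : ℝ), ∫⁻ x, ENNReal.ofReal (Real.exp (-t * nsq x)) ∂(gam K ι)
     = ∫⁻ t in Set.Ioi (0 : ℝ), ENNReal.ofReal ((1 + 2 * t) ^ (-(b / 2))) := by
    refine setLIntegral_congr_fun measurableSet_Ioi fun t ht => ?_
    exact lintegral_exp_gam ι t (le_of_lt ht)
  rw [e2]
  have hd : ∀ t ∈ Set.Ioi (0 : ℝ), HasDerivAt
      (fun t : ℝ => (-1 / (b - 2)) * (1 + 2 * t) ^ (1 - b / 2)) ((1 + 2 * t) ^ (-(b / 2))) t := by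
    intro t ht
    have ht' : (0 : ℝ) < t := ht
    have h1 : HasDerivAt (fun t : ℝ => 1 + 2 * t) 2 t := by
      simpa using ((hasDerivAt_id t).const_mul 2).const_add 1
    have h2 := (h1.rpow_const (p := 1 - b / 2) (Or.inl (by positivity))).const_mul (-1 / (b - 2))
    have h3 : (-1 / (b - 2) * (2 * (1 - b / 2) * (1 + 2 * t) ^ (1 - b / 2 - 1))) =
        (1 + 2 * t) ^ (-(b / 2)) := by
      have : (1 - b / 2 - 1) = -(b / 2) := by ring
      rw [this]
      have : b - 2 ≠ 0 := by linarith
      field_simp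
      ring
    rw [h3] at h2
    exact h2
  have hlim : Tendsto (fun t : ℝ => (-1 / (b - 2)) * (1 + 2 * t) ^ (1 - b / 2)) atTop
      (𝓝 ((-1 / (b - 2)) * 0)) := by
    refine Tendsto.const_mul _ ?_
    have := (tendsto_rpow_neg_atTop (y := b / 2 - 1) (by linarith))
    rw [neg_sub] at this
    refine this.comp ?_
    refine tendsto_atTop_add_const_left _ _ ?_
    exact Tendsto.const_mul_atTop (by norm_num) tendsto_id
  have hcont : ContinuousWithinAt (fun t : ℝ => (-1 / (b - 2)) * (1 + 2 * t) ^ (1 - b / 2))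
      (Set.Ici 0) 0 := by
    apply ContinuousAt.continuousWithinAt
    refine ContinuousAt.mul continuousAt_const ?_
    exact ContinuousAt.rpow_const (by fun_prop) (Or.inl (by norm_num))
  have hnn : ∀ t ∈ Set.Ioi (0 : ℝ), 0 ≤ (1 + 2 * t) ^ (-(b / 2)) := by
    intro t ht
    have ht' : (0 : ℝ) < t := ht
    positivity
  have hint := integrableOn_Ioi_deriv_of_nonneg hcont hd hnn hlim
  have hval := integral_Ioi_of_hasDerivAt_of_nonneg hcont hd hnn hlim
  rw [← ofReal_integral_eq_lintegral_ofReal hint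
    ((ae_restrict_iff' measurableSet_Ioi).2 (ae_of_all _ hnn)), hval]
  apply le_of_eq
  congr 1
  simp
  ring

lemma integral_normsq_K : ∫ x, ‖x‖ ^ 2 ∂(stdGaussian K) = Module.finrank ℝ K := by
  rw [stdGaussian, integral_map (Measurable.aemeasurable (by fun_prop))
    (Measurable.aestronglyMeasurable (by fun_prop))]
  have h : ∀ x : Fin (Module.finrank ℝ K) → ℝ,
      ‖∑ i, x i • stdOrthonormalBasis ℝ K i‖ ^ 2 = ∑ i, (x i) ^ 2 := by
    intro x
    have := (stdOrthonormalBasis ℝ K).sum_sq_norm_inner_right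
      (∑ i, x i • stdOrthonormalBasis ℝ K i)
    rw [← this]
    refine Finset.sum_congr rfl fun i _ => ?_
    simp [inner_sum, inner_smul_right, (stdOrthonormalBasis ℝ K).inner_eq_ite]
  simp_rw [h]
  have hi : Integrable (fun x : ℝ => x ^ 2) (gaussianReal 0 1) :=
    (IsGaussian.memLp_two_id (μ := gaussianReal 0 1)).integrable_sq
  have hv : ∫ x, x ^ 2 ∂(gaussianReal 0 1) = 1 := by
    have := variance_id_gaussianReal (μ := 0) (v := 1)
    rw [variance_eq_integral (by fun_prop)] at this
    simpa using this
  rw [integral_finsetSum]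
  · have : ∀ i, ∫ x : Fin (Module.finrank ℝ K) → ℝ, (x i) ^ 2
        ∂(Measure.pi (fun _ => gaussianReal 0 1)) = 1 := by
      intro i
      rw [← hv]
      exact integral_comp_eval (μ := fun _ => gaussianReal 0 1) (f := fun x => x ^ 2)
        hi.aestronglyMeasurable
    simp [this]
  · intro i _
    exact integrable_comp_eval (μ := fun _ => gaussianReal 0 1) (f := fun x => x ^ 2) hi

lemma alphaK_eq : alphaK K = 2 - Module.finrank ℝ K ∧
    (Module.finrank ℝ K = 1 ∨ Module.finrank ℝ K = 2) := by
  unfold alphaK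
  split_ifs with h
  · have := (RCLike.realLinearIsometryEquiv h).toLinearEquiv.finrank_eq
    rw [this]; simp; norm_num
  · have h' : RCLike.im (RCLike.I : K) = 1 := by
      exact (RCLike.I_eq_zero_or_im_I_eq_one (K := K)).resolve_left h
    have := (RCLike.complexLinearIsometryEquiv h').toLinearEquiv.finrank_eq
    rw [this]; simp
end laplace

section matalg
variable {K : Type*} [RCLike K]

lemma proj_decomp {ι : Type*} [Fintype ι] [DecidableEq ι] (P : Matrix ι ι K) (hP : P.IsHermitian)
    (h2 : P * P = P) (k : ℕ) (ht : P.trace = (k : K)) :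
    ∃ Q : Matrix ι (Fin k) K, Qᴴ * Q = 1 ∧ Q * Qᴴ = P := by
  obtain ⟨U, ev, hUU, hUU', hspec⟩ : ∃ (U : Matrix ι ι K) (ev : ι → ℝ), Uᴴ * U = 1 ∧ U * Uᴴ = 1 ∧
      P = U * diagonal (fun i => (ev i : K)) * Uᴴ := by
    refine ⟨hP.eigenvectorUnitary, hP.eigenvalues, ?_, ?_, ?_⟩
    · exact (Matrix.mem_unitaryGroup_iff').1 hP.eigenvectorUnitary.2
    · exact (Matrix.mem_unitaryGroup_iff).1 hP.eigenvectorUnitary.2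
    · have := hP.spectral_theorem
      rw [Unitary.conjStarAlgAut_apply] at this
      exact this
  set D : Matrix ι ι K := diagonal (fun i => (ev i : K)) with hD
  have hDD : D * D = D := by
    have e : D = Uᴴ * P * U := by
      rw [hspec]
      calc D = (Uᴴ * U) * D * (Uᴴ * U) := by rw [hUU]; simp
        _ = _ := by simp only [Matrix.mul_assoc]
    calc D * D = Uᴴ * P * (U * Uᴴ) * P * U := by rw [e]; simp only [Matrix.mul_assoc]
      _ = Uᴴ * (P * P) * U := by rw [hUU']; simp only [Matrix.mul_assoc, Matrix.mul_one]
      _ = D := by rw [h2, e]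
  have hev : ∀ i, ev i = 0 ∨ ev i = 1 := by
    intro i
    have := congrFun (congrFun hDD i) i
    simp only [hD, diagonal_mul_diagonal, diagonal_apply_eq] at this
    have h3 : ev i * ev i = ev i := by exact_mod_cast this
    rcases eq_or_ne (ev i) 0 with h | h
    · exact Or.inl h
    · exact Or.inr (mul_left_cancel₀ h (by rw [h3, mul_one]))
  classical
  have hcard : Fintype.card {i // ev i = 1} = k := by
    have : (Fintype.card {i // ev i = 1} : K) = k := by
      rw [← ht, hspec, Matrix.trace_mul_comm, ← Matrix.mul_assoc, hUU, Matrix.one_mul, hD,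
        trace_diagonal, Fintype.card_subtype, Finset.card_filter]
      push_cast
      refine Finset.sum_congr rfl fun i _ => ?_
      rcases hev i with h | h <;> simp [h]
    exact_mod_cast this
  let e : Fin k ≃ {i // ev i = 1} := (Fintype.equivFinOfCardEq hcard).symm
  refine ⟨U.submatrix id (fun a => (e a : ι)), ?_, ?_⟩
  · have hinj : Function.Injective (fun a => (e a : ι)) :=
      Subtype.val_injective.comp e.injective
    have : (U.submatrix id (fun a => (e a : ι)))ᴴ * U.submatrix id (fun a => (e a : ι)) =
        (Uᴴ * U).submatrix (fun a => (e a : ι)) (fun a => (e a : ι)) := by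
      ext a b; simp [Matrix.mul_apply]
    rw [this, hUU, submatrix_one _ hinj]
  · ext i j
    rw [hspec]
    rw [Matrix.mul_apply, Matrix.mul_apply, hD]
    simp only [mul_diagonal, submatrix_apply, id, conjTranspose_apply]
    rw [e.sum_comp (fun a : {i // ev i = 1} => U i a * star (U j a))]
    have : ∀ x, U i x * (ev x : K) * star (U j x) =
        if ev x = 1 then U i x * star (U j x) else 0 := by
      intro x; rcases hev x with h | h <;> simp [h]
    simp_rw [this]
    rw [← Finset.sum_filter]
    exact (Finset.sum_subtype _ (by simp) (fun x => U i x * star (U j x))).symm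

/-- Matrix with given columns. -/
def cm {κ ι : Type*} (N : κ → ι → K) : Matrix ι κ K := of fun i j => N j i

lemma cs_nsq {ι : Type*} [Fintype ι] (u v : ι → K) :
    ‖star u ⬝ᵥ v‖ ^ 2 ≤ nsq u * nsq v := by
  have h1 : ‖star u ⬝ᵥ v‖ ≤ ∑ i, ‖u i‖ * ‖v i‖ := by
    refine (norm_sum_le _ _).trans (le_of_eq ?_)
    simp
  calc ‖star u ⬝ᵥ v‖ ^ 2 ≤ (∑ i, ‖u i‖ * ‖v i‖) ^ 2 := by gcongr
    _ ≤ _ := Finset.sum_mul_sq_le_sq_mul_sq _ _ _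

lemma nsq_nonneg {ι : Type*} [Fintype ι] (u : ι → K) : 0 ≤ nsq u := by unfold nsq; positivity

lemma nsq_zero {ι : Type*} [Fintype ι] : nsq (0 : ι → K) = 0 := by simp [nsq]

lemma proj_facts {ι κ : Type*} [Fintype ι] [Fintype κ] [DecidableEq ι] [DecidableEq κ]
    (A : Matrix ι κ K) (hdet : IsUnit (Aᴴ * A).det) :
    (A * (Aᴴ * A)⁻¹ * Aᴴ).IsHermitian ∧
    (A * (Aᴴ * A)⁻¹ * Aᴴ) * (A * (Aᴴ * A)⁻¹ * Aᴴ) = A * (Aᴴ * A)⁻¹ * Aᴴ ∧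
    (A * (Aᴴ * A)⁻¹ * Aᴴ).trace = (Fintype.card κ : K) ∧
    (A * (Aᴴ * A)⁻¹ * Aᴴ) * A = A := by
  have h4 : (A * (Aᴴ * A)⁻¹ * Aᴴ) * A = A := by
    rw [Matrix.mul_assoc, Matrix.mul_assoc, Matrix.nonsing_inv_mul _ hdet, Matrix.mul_one]
  refine ⟨?_, ?_, ?_, h4⟩
  · unfold IsHermitian
    simp only [conjTranspose_mul, conjTranspose_conjTranspose, conjTranspose_nonsing_inv,
      Matrix.mul_assoc]
  · rw [← Matrix.mul_assoc, ← Matrix.mul_assoc, h4]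
  · rw [Matrix.mul_assoc, Matrix.trace_mul_comm, Matrix.mul_assoc,
      Matrix.nonsing_inv_mul _ hdet, trace_one]

lemma gram_isUnit {ι κ : Type*} [Fintype ι] [Fintype κ] [DecidableEq κ]
    (A : Matrix ι κ K) : IsUnit (Aᴴ * A).det ↔ ∀ c, A *ᵥ c = 0 → c = 0 := by
  rw [isUnit_iff_ne_zero, ne_eq, ← Matrix.exists_mulVec_eq_zero_iff]
  push Not
  constructor
  · intro h c hc
    by_contra hne
    exact h c hne (by rw [← mulVec_mulVec, hc, mulVec_zero])
  · intro h c hne hc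
    exact hne (h c ((Matrix.conjTranspose_mul_self_mulVec_eq_zero A c).1 hc))

lemma key_col {ι : Type*} [Fintype ι] [DecidableEq ι] {m : ℕ} (hm : m ≤ Fintype.card ι)
    (N' : Fin m → ι → K) (hdet : IsUnit ((cm N')ᴴ * cm N').det) (j : Fin (m + 1)) :
    ∃ Q : Matrix ι (Fin (Fintype.card ι - m)) K, Qᴴ * Q = 1 ∧ ∀ x : ι → K,
      nsq (Qᴴ *ᵥ x) ≠ 0 →
      IsUnit ((cm (j.insertNth (α := fun _ => ι → K) x N'))ᴴ *
        cm (j.insertNth (α := fun _ => ι → K) x N')).det ∧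
      1 / nsq (Qᴴ *ᵥ x) ≤ RCLike.re (((cm (j.insertNth (α := fun _ => ι → K) x N'))ᴴ *
        cm (j.insertNth (α := fun _ => ι → K) x N'))⁻¹ j j) := by
  set A := cm N' with hA
  obtain ⟨p1, p2, p3, p4⟩ := proj_facts A hdet
  set Pr := A * (Aᴴ * A)⁻¹ * Aᴴ with hPr
  obtain ⟨Q, hQ1, hQ2⟩ := proj_decomp (1 - Pr) (isHermitian_one.sub p1)
    (by rw [Matrix.mul_sub, Matrix.sub_mul, Matrix.sub_mul, p2]; simp)
    (Fintype.card ι - m) (by rw [trace_sub, trace_one, p3, Nat.cast_sub hm]; simp)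
  have hQA : Qᴴ * A = 0 := by
    calc Qᴴ * A = (Qᴴ * Q) * (Qᴴ * A) := by rw [hQ1, Matrix.one_mul]
      _ = Qᴴ * ((Q * Qᴴ) * A) := by simp only [Matrix.mul_assoc]
      _ = 0 := by rw [hQ2, Matrix.sub_mul, p4]; simp
  refine ⟨Q, hQ1, fun x hx => ?_⟩
  set B := cm (j.insertNth (α := fun _ => ι → K) x N') with hB
  have hBc : ∀ c : Fin (m + 1) → K, B *ᵥ c = c j • x + A *ᵥ (fun i => c (j.succAbove i)) := by
    intro c
    ext i
    simp [mulVec, dotProduct, hB, hA, cm, Fin.sum_univ_succAbove _ j, mul_comm]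
  have hBj : ∀ w : ι → K, (Bᴴ *ᵥ w) j = star x ⬝ᵥ w := by
    intro w
    simp [mulVec, dotProduct, hB, cm]
  have hBi : ∀ (w : ι → K) i, (Bᴴ *ᵥ w) (j.succAbove i) = (Aᴴ *ᵥ w) i := by
    intro w i
    simp [mulVec, dotProduct, hB, hA, cm]
  have hunit : IsUnit (Bᴴ * B).det := by
    rw [gram_isUnit]
    intro c hc
    rw [hBc] at hc
    have h1 : c j • (Qᴴ *ᵥ x) = 0 := by
      have := congrArg (Qᴴ *ᵥ ·) hc
      simpa [mulVec_add, mulVec_smul, mulVec_mulVec, hQA] using this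
    have hcj : c j = 0 := by
      rcases smul_eq_zero.1 h1 with h | h
      · exact h
      · rw [h] at hx; exact absurd nsq_zero hx
    rw [hcj, zero_smul, zero_add] at hc
    have h2 := (gram_isUnit A).1 hdet _ hc
    ext i
    rcases Fin.eq_self_or_eq_succAbove j i with h | ⟨i', h⟩
    · rw [h, hcj]; rfl
    · rw [h]; exact congrFun h2 i'
  refine ⟨hunit, ?_⟩
  set W := (Bᴴ * B)⁻¹ with hW
  set ej : Fin (m + 1) → K := Pi.single j 1 with hej
  set w := B *ᵥ (W *ᵥ ej) with hw
  have hBw : Bᴴ *ᵥ w = ej := by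
    rw [hw, mulVec_mulVec, mulVec_mulVec, Matrix.mul_nonsing_inv _ hunit, one_mulVec]
  have hxw : star x ⬝ᵥ w = 1 := by rw [← hBj, hBw, hej]; simp
  have hAw : Aᴴ *ᵥ w = 0 := by
    ext i; rw [← hBi, hBw, hej]; simp [Fin.succAbove_ne]
  have hPw : (Q * Qᴴ) *ᵥ w = w := by
    rw [hQ2, sub_mulVec, one_mulVec, hPr, ← mulVec_mulVec, hAw]; simp
  have hWjj : RCLike.re (W j j) = nsq w := by
    have h1 : ((nsq w : ℝ) : K) = star (W j j) := by
      rw [nsq_eq]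
      nth_rw 1 [hw]
      rw [star_mulVec, ← dotProduct_mulVec, hBw, hej]
      simp
    have h2 := congrArg RCLike.re h1
    simpa using h2.symm
  have hn : nsq (Qᴴ *ᵥ w) = nsq w := by
    have : ((nsq (Qᴴ *ᵥ w) : ℝ) : K) = (nsq w : ℝ) := by
      rw [nsq_eq, nsq_eq, star_mulVec, ← dotProduct_mulVec, mulVec_mulVec,
        conjTranspose_conjTranspose, hPw]
    exact_mod_cast this
  have hone : star (Qᴴ *ᵥ x) ⬝ᵥ (Qᴴ *ᵥ w) = 1 := by
    rw [star_mulVec, ← dotProduct_mulVec, mulVec_mulVec, conjTranspose_conjTranspose, hPw, hxw]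
  have hcs := cs_nsq (Qᴴ *ᵥ x) (Qᴴ *ᵥ w)
  rw [hone, hn] at hcs
  simp only [norm_one, one_pow] at hcs
  rw [hWjj, div_le_iff₀ (lt_of_le_of_ne (nsq_nonneg _) (Ne.symm hx)), mul_comm]
  exact hcs

end matalg

section meas
variable {K : Type*} [RCLike K] [MeasurableSpace K] [BorelSpace K]

/-- Entrywise measurability of a matrix-valued map. -/
def ME {X : Type*} [MeasurableSpace X] {ι κ : Type*} (f : X → Matrix ι κ K) : Prop :=
  ∀ i j, Measurable fun x => f x i j

variable {X : Type*} [MeasurableSpace X] {ι κ τ : Type*}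

lemma ME.mul [Fintype κ] {f : X → Matrix ι κ K} {g : X → Matrix κ τ K} (hf : ME f) (hg : ME g) :
    ME (fun x => f x * g x) := by
  intro i j
  simp only [Matrix.mul_apply]
  exact Finset.measurable_sum _ fun k _ => (hf i k).mul (hg k j)

lemma ME.conjT {f : X → Matrix ι κ K} (hf : ME f) : ME (fun x => (f x)ᴴ) := by
  intro i j
  simp only [conjTranspose_apply, RCLike.star_def]
  exact (RCLike.continuous_conj.measurable).comp (hf j i)

lemma ME.sub {f g : X → Matrix ι κ K} (hf : ME f) (hg : ME g) : ME (fun x => f x - g x) := by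
  intro i j
  simp only [Matrix.sub_apply]
  exact (hf i j).sub (hg i j)

lemma ME.const (A : Matrix ι κ K) : ME (fun _ : X => A) := fun _ _ => measurable_const

lemma ME.det [Fintype ι] [DecidableEq ι] {f : X → Matrix ι ι K} (hf : ME f) :
    Measurable (fun x => (f x).det) := by
  simp only [Matrix.det_apply]
  refine Finset.measurable_sum _ fun σ _ => ?_
  refine Measurable.const_smul ?_ _
  exact Finset.measurable_prod _ fun i _ => hf _ _

lemma ME.inv [Fintype ι] [DecidableEq ι] {f : X → Matrix ι ι K} (hf : ME f) :
    ME (fun x => (f x)⁻¹) := by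
  intro i j
  simp only [Matrix.inv_def, Matrix.smul_apply, Ring.inverse_eq_inv', adjugate_apply, smul_eq_mul]
  refine hf.det.inv.mul ?_
  refine ME.det ?_
  intro a b
  simp only [updateRow_apply]
  split_ifs
  · exact measurable_const
  · exact hf a b

lemma ME.trace [Fintype ι] {f : X → Matrix ι ι K} (hf : ME f) :
    Measurable (fun x => RCLike.re (f x).trace) := by
  refine (RCLike.continuous_re.measurable).comp ?_
  simp only [Matrix.trace, Matrix.diag]
  exact Finset.measurable_sum _ fun i _ => hf i i

lemma ME.frob [Fintype ι] [Fintype κ] {f : X → Matrix ι κ K} (hf : ME f) :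
    Measurable (fun x => frobSq (f x)) := by
  unfold frobSq
  exact Finset.measurable_sum _ fun i _ => Finset.measurable_sum _ fun j _ =>
    (hf i j).norm.pow_const 2

lemma ME.cm {g : X → κ → ι → K} (hg : Measurable g) : ME (fun x => cm (g x)) := by
  intro i j
  exact (measurable_pi_apply i).comp ((measurable_pi_apply j).comp hg)

end meas

section cols
variable {K : Type*} [RCLike K] [MeasurableSpace K] [BorelSpace K]

variable (K) in
/-- `r` independent Gaussian columns. -/
def gcols (r : ℕ) (ι : Type*) [Fintype ι] : Measure (Fin r → ι → K) :=
  Measure.pi (fun _ => gam K ι)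

instance gcols_prob (r : ℕ) (ι : Type*) [Fintype ι] : IsProbabilityMeasure (gcols K r ι) := by
  unfold gcols; infer_instance

lemma gcols_split (m : ℕ) (ι : Type*) [Fintype ι] (j : Fin (m + 1)) :
    MeasurePreserving (fun p : (ι → K) × (Fin m → ι → K) =>
      (j.insertNth (α := fun _ => ι → K) p.1 p.2 : Fin (m + 1) → ι → K))
      ((gam K ι).prod (gcols K m ι)) (gcols K (m + 1) ι) := by
  have := (measurePreserving_piFinSuccAbove (fun _ : Fin (m + 1) => gam K ι) j).symm
  exact this

lemma ae_nonsing {ι : Type*} [Fintype ι] [DecidableEq ι] (m : ℕ) (hm : m ≤ Fintype.card ι) :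
    ∀ᵐ N ∂(gcols K m ι), IsUnit ((cm N)ᴴ * cm N).det := by
  induction m with
  | zero => exact ae_of_all _ fun N => by simp
  | succ m ih =>
    have hms : MeasurableSet {N : Fin (m + 1) → ι → K | IsUnit ((cm N)ᴴ * cm N).det} := by
      simp only [isUnit_iff_ne_zero]
      have h : ME (fun N : Fin (m + 1) → ι → K => cm N) := ME.cm measurable_id
      have := (h.conjT.mul h).det
      exact (this (measurableSet_singleton 0)).compl
    have hsp := gcols_split (K := K) m ι 0
    rw [← hsp.map_eq, ae_map_iff hsp.measurable.aemeasurable hms]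
    have hms' := hsp.measurable hms
    suffices key : ∀ᵐ N' ∂(gcols K m ι), ∀ᵐ x ∂(gam K ι),
        IsUnit ((cm (Fin.insertNth (α := fun _ => ι → K) 0 x N' : Fin (m+1) → ι → K))ᴴ *
          cm (Fin.insertNth (α := fun _ => ι → K) 0 x N' : Fin (m+1) → ι → K)).det by
      exact (Measure.ae_prod_iff_ae_ae hms').2 ((Measure.ae_ae_comm (p := fun x N' =>
      IsUnit ((cm (Fin.insertNth (α := fun _ => ι → K) 0 x N' : Fin (m+1) → ι → K))ᴴ *
      cm (Fin.insertNth (α := fun _ => ι → K) 0 x N' : Fin (m+1) → ι → K)).det) hms').2 key)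
    filter_upwards [ih (by omega)] with N' hN'
    obtain ⟨Q, hQ, hx⟩ := key_col (by omega) N' hN' 0
    have : Nonempty (Fin (Fintype.card ι - m)) := ⟨⟨0, by omega⟩⟩
    have h1 := gam_ne_zero (K := K) (Fin (Fintype.card ι - m))
    have h2 := (gam_map Q hQ).quasiMeasurePreserving.ae h1
    filter_upwards [h2] with x hx2
    exact (hx x hx2).1

lemma inv_wishart {ι : Type*} [Fintype ι] [DecidableEq ι] (m : ℕ) (hm : m ≤ Fintype.card ι)
    (hb : (2 : ℝ) < Module.finrank ℝ K * ((Fintype.card ι - m : ℕ) : ℝ)) (j : Fin (m + 1)) :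
    ENNReal.ofReal (1 / (Module.finrank ℝ K * ((Fintype.card ι - m : ℕ) : ℝ) - 2)) ≤
    ∫⁻ N, ENNReal.ofReal (RCLike.re (((cm N)ᴴ * cm N)⁻¹ j j)) ∂(gcols K (m + 1) ι) := by
  have hme : Measurable (fun N : Fin (m + 1) → ι → K =>
      ENNReal.ofReal (RCLike.re (((cm N)ᴴ * cm N)⁻¹ j j))) := by
    have h : ME (fun N : Fin (m + 1) → ι → K => cm N) := ME.cm measurable_id
    exact ENNReal.measurable_ofReal.comp (RCLike.continuous_re.measurable.comp ((h.conjT.mul h).inv j j))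
  have hsp := gcols_split (K := K) m ι j
  rw [← hsp.lintegral_comp hme]
  refine le_trans ?_ (le_of_eq (lintegral_prod_symm _ (hme.comp hsp.measurable).aemeasurable).symm)
  set c := ENNReal.ofReal (1 / (Module.finrank ℝ K * ((Fintype.card ι - m : ℕ) : ℝ) - 2)) with hc
  calc c = ∫⁻ _, c ∂(gcols K m ι) := by simp
    _ ≤ _ := by
      refine lintegral_mono_ae ?_
      filter_upwards [ae_nonsing (K := K) m hm] with N' hN'
      obtain ⟨Q, hQ, hx⟩ := key_col hm N' hN' j
      have h1 := lintegral_inv_gam (K := K) (Fin (Fintype.card ι - m)) (by simpa using hb)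
      rw [Fintype.card_fin] at h1
      refine h1.trans ?_
      have hmm : Measurable (fun x : Fin (Fintype.card ι - m) → K =>
          ENNReal.ofReal (1 / nsq x)) := by
        unfold nsq; fun_prop
      rw [← (gam_map Q hQ).lintegral_comp hmm]
      refine lintegral_mono fun x => ?_
      by_cases h0 : nsq (Qᴴ *ᵥ x) = 0
      · simp [h0]
      · exact ENNReal.ofReal_le_ofReal (hx x h0).2

lemma row_integral {r : ℕ} {τ : Type*} [Fintype τ] (i : τ) (j k : Fin r) :
    Integrable (fun H : Fin r → τ → K => star (H j i) * H k i) (gcols K r τ) ∧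
    ∫ H, star (H j i) * H k i ∂(gcols K r τ) = if j = k then (Module.finrank ℝ K : K) else 0 := by
  have hev : MeasurePreserving (fun (H : Fin r → τ → K) => fun j => H j i) (gcols K r τ)
      (Measure.pi (fun _ => stdGaussian K)) := by
    unfold gcols gam
    exact measurePreserving_pi (fun _ : Fin r => Measure.pi (fun _ : τ => stdGaussian K))
      (fun _ => stdGaussian K) (fun _ => measurePreserving_eval _ i)
  have hL2 : MemLp (fun x : K => x) 2 (stdGaussian K) := IsGaussian.memLp_two_id
  have hL : ∀ j : Fin r, MemLp (fun x : Fin r → K => x j) 2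
      (Measure.pi (fun _ => stdGaussian K)) := fun j =>
    hL2.comp_measurePreserving (measurePreserving_eval (fun _ => stdGaussian K) j)
  have hstar : MemLp (fun x : Fin r → K => star (x j)) 2 (Measure.pi (fun _ => stdGaussian K)) := by
    exact (hL j).star
  have hint : Integrable (fun x : Fin r → K => star (x j) * x k)
      (Measure.pi (fun _ => stdGaussian K)) := hstar.integrable_mul (hL k)
  refine ⟨hev.integrable_comp_of_integrable hint, ?_⟩
  have hcomp : ∫ H, star (H j i) * H k i ∂(gcols K r τ) =
      ∫ x, star (x j) * x k ∂(Measure.pi (fun _ : Fin r => stdGaussian K)) := by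
    rw [← hev.map_eq, integral_map hev.measurable.aemeasurable]
    rw [hev.map_eq]; exact hint.aestronglyMeasurable
  rw [hcomp]
  split_ifs with h
  · subst h
    have h1 : ∀ x : Fin r → K, star (x j) * x j = ((‖x j‖ ^ 2 : ℝ) : K) := by
      intro x; rw [RCLike.star_def, RCLike.conj_mul]; push_cast; rfl
    simp_rw [h1]
    rw [integral_ofReal,
      integral_comp_eval (μ := fun _ : Fin r => stdGaussian K) (f := fun x : K => ‖x‖ ^ 2)
        (by apply Continuous.aestronglyMeasurable; fun_prop), integral_normsq_K]
    simp
  · set Q : Matrix (Fin r) (Fin r) K := diagonal (fun i => if i = j then -1 else 1) with hQ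
    have hQQ : Qᴴ * Q = 1 := by
      rw [hQ, diagonal_conjTranspose, diagonal_mul_diagonal, ← diagonal_one]
      congr 1
      ext i
      by_cases hi : i = j <;> simp [hi]
    have hmp := gam_map Q hQQ
    have h1 : ∫ x, star (x j) * x k ∂(gam K (Fin r)) =
        ∫ x, star ((Qᴴ *ᵥ x) j) * (Qᴴ *ᵥ x) k ∂(gam K (Fin r)) := by
      nth_rw 1 [← hmp.map_eq]
      rw [integral_map hmp.measurable.aemeasurable]
      rw [hmp.map_eq]; exact hint.aestronglyMeasurable
    have h2 : ∀ x : Fin r → K, star ((Qᴴ *ᵥ x) j) * (Qᴴ *ᵥ x) k = -(star (x j) * x k) := by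
      intro x
      rw [hQ, diagonal_conjTranspose, mulVec_diagonal, mulVec_diagonal]
      simp [Ne.symm h]
    simp_rw [h2] at h1
    rw [integral_neg] at h1
    exact self_eq_neg.1 h1

lemma inner_integral {r : ℕ} {τ : Type*} [Fintype τ] (W : Matrix (Fin r) (Fin r) K)
    (hW : W.PosSemidef) :
    ∫⁻ H, ENNReal.ofReal (RCLike.re (((cm H)ᴴ * cm H) * W).trace) ∂(gcols K r τ) =
    ENNReal.ofReal (Module.finrank ℝ K * Fintype.card τ * RCLike.re W.trace) := by
  have hexp : ∀ H : Fin r → τ → K, (((cm H)ᴴ * cm H) * W).trace =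
      ∑ j, ∑ k, ∑ i, (star (H j i) * H k i) * W k j := by
    intro H
    simp only [Matrix.trace, Matrix.diag, Matrix.mul_apply, conjTranspose_apply, cm, of_apply,
      Finset.sum_mul]
  have hint : Integrable (fun H : Fin r → τ → K => (((cm H)ᴴ * cm H) * W).trace)
      (gcols K r τ) := by
    simp_rw [hexp]
    refine integrable_finsetSum _ fun j _ => integrable_finsetSum _ fun k _ =>
      integrable_finsetSum _ fun i _ => (row_integral i j k).1.mul_const _
  have hval : ∫ H, (((cm H)ᴴ * cm H) * W).trace ∂(gcols K r τ) =
      (Module.finrank ℝ K : K) * Fintype.card τ * W.trace := by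
    simp_rw [hexp]
    rw [integral_finsetSum]
    swap
    · exact fun j _ => integrable_finsetSum _ fun k _ =>
        integrable_finsetSum _ fun i _ => (row_integral i j k).1.mul_const _
    have : ∀ j : Fin r, ∫ H : Fin r → τ → K, ∑ k, ∑ i, (star (H j i) * H k i) * W k j
        ∂(gcols K r τ) = (Module.finrank ℝ K : K) * Fintype.card τ * W j j := by
      intro j
      rw [integral_finsetSum]
      swap
      · exact fun k _ =>
          integrable_finsetSum _ fun i _ => (row_integral i j k).1.mul_const _
      rw [Finset.sum_eq_single j]
      · rw [integral_finsetSum _ fun i _ => (row_integral i j j).1.mul_const _]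
        simp_rw [integral_mul_const, (row_integral _ j j).2]
        simp
        ring
      · intro k _ hk
        rw [integral_finsetSum _ fun i _ => (row_integral i j k).1.mul_const _]
        simp_rw [integral_mul_const, (row_integral _ j k).2]
        simp [Ne.symm hk]
      · simp
    simp_rw [this]
    rw [← Finset.mul_sum]
    rfl
  rw [← ofReal_integral_eq_lintegral_ofReal hint.re]
  · congr 1
    rw [integral_re hint, hval]
    have : (Module.finrank ℝ K : K) * Fintype.card τ =
        ((Module.finrank ℝ K * Fintype.card τ : ℝ) : K) := by push_cast; rfl
    rw [this, RCLike.re_ofReal_mul]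
  · refine ae_of_all _ fun H => ?_
    simp only [Pi.zero_apply]
    rw [Matrix.mul_assoc, Matrix.trace_mul_comm]
    have := (hW.mul_mul_conjTranspose_same (cm H)).trace_nonneg
    exact (RCLike.nonneg_iff.1 this).1
end cols

section fixedproj
variable {K : Type*} [RCLike K] [MeasurableSpace K] [BorelSpace K]

lemma gam_split {ι τ τ' : Type*} [Fintype ι] [Fintype τ] [Fintype τ'] [DecidableEq ι]
    [DecidableEq τ] [DecidableEq τ'] (Q : Matrix ι τ K) (Q' : Matrix ι τ' K)
    (hQ : Qᴴ * Q = 1) (hQ' : Q'ᴴ * Q' = 1) (hQQ : Qᴴ * Q' = 0) :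
    MeasurePreserving (fun x => (Qᴴ *ᵥ x, Q'ᴴ *ᵥ x)) (gam K ι) ((gam K τ).prod (gam K τ')) := by
  have hQQ2 : Q'ᴴ * Q = 0 := by
    rw [← conjTranspose_inj, conjTranspose_mul, conjTranspose_conjTranspose, hQQ]; simp
  have hU : (fromCols Q Q')ᴴ * fromCols Q Q' = 1 := by
    rw [conjTranspose_fromCols_eq_fromRows_conjTranspose, fromRows_mul_fromCols, hQ, hQ', hQQ, hQQ2,
      fromBlocks_one]
  have h1 := gam_map (fromCols Q Q') hU
  have h2 := measurePreserving_sumPiEquivProdPi (fun _ : τ ⊕ τ' => stdGaussian K)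
  have h3 := MeasurePreserving.comp (μb := gam K (τ ⊕ τ')) h2 h1
  have he : (fun x => (Qᴴ *ᵥ x, Q'ᴴ *ᵥ x)) = (MeasurableEquiv.sumPiEquivProdPi
      (fun _ : τ ⊕ τ' => K)) ∘ (fun x : ι → K => (fromCols Q Q')ᴴ *ᵥ x) := by
    funext x
    refine Prod.ext ?_ ?_
    · funext i
      change _ = ((fromCols Q Q')ᴴ *ᵥ x) (Sum.inl i)
      simp [conjTranspose_fromCols_eq_fromRows_conjTranspose, fromRows_mulVec]
    · funext i
      change _ = ((fromCols Q Q')ᴴ *ᵥ x) (Sum.inr i)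
      simp [conjTranspose_fromCols_eq_fromRows_conjTranspose, fromRows_mulVec]
  rw [he]
  exact h3

lemma gcols_split2 {ι τ τ' : Type*} [Fintype ι] [Fintype τ] [Fintype τ'] [DecidableEq ι]
    [DecidableEq τ] [DecidableEq τ'] (Q : Matrix ι τ K) (Q' : Matrix ι τ' K)
    (hQ : Qᴴ * Q = 1) (hQ' : Q'ᴴ * Q' = 1) (hQQ : Qᴴ * Q' = 0) (r : ℕ) :
    MeasurePreserving (fun G : Fin r → ι → K => (fun j => Qᴴ *ᵥ G j, fun j => Q'ᴴ *ᵥ G j))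
      (gcols K r ι) ((gcols K r τ).prod (gcols K r τ')) := by
  have h1 := measurePreserving_pi (fun _ : Fin r => gam K ι)
    (fun _ => (gam K τ).prod (gam K τ')) (fun _ => gam_split Q Q' hQ hQ' hQQ)
  have h2 := measurePreserving_arrowProdEquivProdArrow (τ → K) (τ' → K) (Fin r)
    (fun _ => gam K τ) (fun _ => gam K τ')
  exact h2.comp h1

/-- The excess-risk functional. -/
def Phi {n r : ℕ} (P : Matrix (Fin n) (Fin n) K) (G : Matrix (Fin n) (Fin r) K) : ℝ :=
  RCLike.re (Gᴴ * (1 - P) * G * (Gᴴ * P * G)⁻¹).trace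

lemma cm_mulVec {ι τ : Type*} [Fintype ι] {r : ℕ} (Q : Matrix τ ι K) (G : Fin r → ι → K) :
    cm (fun j => Q *ᵥ G j) = Q * cm G := by
  ext i j
  simp [cm, mulVec, Matrix.mul_apply, dotProduct]

lemma Phi_lower {n ℓ m : ℕ} (hℓn : ℓ ≤ n) (hm : m + 1 ≤ ℓ)
    (hb : (0 : ℝ) < (ℓ : ℝ) - ((m + 1 : ℕ) : ℝ) - alphaK K)
    (P : Matrix (Fin n) (Fin n) K) (hP : P.IsHermitian) (hPP : P * P = P)
    (htr : P.trace = (ℓ : K)) :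
    ENNReal.ofReal (((m + 1 : ℕ) : ℝ) * (n - ℓ) / ((ℓ : ℝ) - ((m + 1 : ℕ) : ℝ) - alphaK K)) ≤
    ∫⁻ G, ENNReal.ofReal (Phi P (cm G)) ∂(gcols K (m + 1) (Fin n)) := by
  obtain ⟨Q, hQ, hQP⟩ := proj_decomp P hP hPP ℓ htr
  obtain ⟨Q', hQ', hQP'⟩ := proj_decomp (1 - P) (isHermitian_one.sub hP)
    (by rw [sub_mul, mul_sub, mul_sub, hPP]; simp) (n - ℓ)
    (by rw [trace_sub, htr, trace_one, Fintype.card_fin, Nat.cast_sub hℓn])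
  have hQQ : Qᴴ * Q' = 0 := by
    have h0 : P * (1 - P) = 0 := by rw [mul_sub, hPP]; simp
    calc Qᴴ * Q' = (Qᴴ * Q) * (Qᴴ * Q') * (Q'ᴴ * Q') := by rw [hQ, hQ']; simp
      _ = Qᴴ * ((Q * Qᴴ) * (Q' * Q'ᴴ)) * Q' := by simp only [Matrix.mul_assoc]
      _ = 0 := by rw [hQP, hQP', h0]; simp
  have hmp := gcols_split2 Q Q' hQ hQ' hQQ (m + 1)
  set F : (Fin (m+1) → Fin ℓ → K) × (Fin (m+1) → Fin (n - ℓ) → K) → ℝ≥0∞ := fun q =>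
    ENNReal.ofReal (RCLike.re (((cm q.2)ᴴ * cm q.2) * ((cm q.1)ᴴ * cm q.1)⁻¹).trace) with hF
  have hFm : Measurable F := by
    refine ENNReal.measurable_ofReal.comp (ME.trace ?_)
    have e1 : ME (fun q : (Fin (m+1) → Fin ℓ → K) × (Fin (m+1) → Fin (n - ℓ) → K) => cm q.1) :=
      ME.cm measurable_fst
    have e2 : ME (fun q : (Fin (m+1) → Fin ℓ → K) × (Fin (m+1) → Fin (n - ℓ) → K) => cm q.2) :=
      ME.cm measurable_snd
    exact (e2.conjT.mul e2).mul (e1.conjT.mul e1).inv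
  have hPhi : ∀ G : Fin (m+1) → Fin n → K, ENNReal.ofReal (Phi P (cm G)) =
      F (fun j => Qᴴ *ᵥ G j, fun j => Q'ᴴ *ᵥ G j) := by
    intro G
    simp only [hF, cm_mulVec, Phi]
    rw [← hQP', ← hQP]
    simp only [conjTranspose_mul, conjTranspose_conjTranspose, Matrix.mul_assoc]
  simp_rw [hPhi]
  rw [hmp.lintegral_comp hFm, lintegral_prod _ hFm.aemeasurable]
  have hps : ∀ N : Fin (m+1) → Fin ℓ → K, ((cm N)ᴴ * cm N)⁻¹.PosSemidef := fun N =>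
    (posSemidef_conjTranspose_mul_self (cm N)).inv
  simp only [hF, inner_integral _ (hps _), Fintype.card_fin]
  have hsum : ∀ N : Fin (m+1) → Fin ℓ → K,
      ENNReal.ofReal (Module.finrank ℝ K * ((n - ℓ : ℕ) : ℝ) * RCLike.re ((cm N)ᴴ * cm N)⁻¹.trace) =
      ENNReal.ofReal (Module.finrank ℝ K * ((n - ℓ : ℕ) : ℝ)) *
        ∑ j, ENNReal.ofReal (RCLike.re (((cm N)ᴴ * cm N)⁻¹ j j)) := by
    intro N
    rw [ENNReal.ofReal_mul (by positivity), ← ENNReal.ofReal_sum_of_nonneg]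
    · simp [Matrix.trace]
    · intro j _
      exact (RCLike.nonneg_iff.1 ((hps N).diag_nonneg)).1
  have hme : ∀ j, Measurable (fun N : Fin (m + 1) → Fin ℓ → K =>
      ENNReal.ofReal (RCLike.re (((cm N)ᴴ * cm N)⁻¹ j j))) := by
    intro j
    have h : ME (fun N : Fin (m + 1) → Fin ℓ → K => cm N) := ME.cm measurable_id
    exact ENNReal.measurable_ofReal.comp
      (RCLike.continuous_re.measurable.comp ((h.conjT.mul h).inv j j))
  simp_rw [hsum]
  rw [lintegral_const_mul _ (Finset.measurable_sum _ fun j _ => hme j),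
    lintegral_finset_sum _ fun j _ => hme j]
  obtain ⟨ha, hbeta⟩ := alphaK_eq (K := K)
  have hcast : ((ℓ - m : ℕ) : ℝ) = (ℓ : ℝ) - m := by rw [Nat.cast_sub (by omega)]
  rw [ha] at hb ⊢
  push_cast at hb
  have hb2 : (2 : ℝ) < Module.finrank ℝ K * ((Fintype.card (Fin ℓ) - m : ℕ) : ℝ) := by
    rw [Fintype.card_fin, hcast]
    rcases hbeta with h | h <;> rw [h] at hb ⊢ <;> push_cast at hb ⊢ <;> linarith
  have hiw := fun j => inv_wishart (K := K) (ι := Fin ℓ) m (by simp; omega) hb2 j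
  refine le_trans (le_of_eq ?_) (mul_le_mul_right (Finset.sum_le_sum fun j _ => hiw j) _)
  rw [← ENNReal.ofReal_sum_of_nonneg (fun _ _ => one_div_nonneg.2 (by linarith)),
    ← ENNReal.ofReal_mul (by positivity)]
  congr 1
  rw [Fintype.card_fin, hcast] at *
  simp only [Finset.sum_const, Finset.card_univ, Fintype.card_fin, nsmul_eq_mul]
  rw [Nat.cast_sub hℓn]
  rcases hbeta with h | h <;> rw [h] at hb hb2 ⊢ <;> push_cast at hb hb2 ⊢
  · have h1 : (ℓ : ℝ) - (m + 1) - (2 - 1) ≠ 0 := by linarith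
    have e : 1 * ((ℓ : ℝ) - m) - 2 = (ℓ : ℝ) - (m + 1) - (2 - 1) := by ring
    rw [e]
    generalize (ℓ : ℝ) - (m + 1) - (2 - 1) = z at h1
    field_simp
  · have h1 : (ℓ : ℝ) - (m + 1) - (2 - 2) ≠ 0 := by linarith
    have e : 2 * ((ℓ : ℝ) - m) - 2 = 2 * ((ℓ : ℝ) - (m + 1) - (2 - 2)) := by ring
    rw [e]
    generalize (ℓ : ℝ) - (m + 1) - (2 - 2) = z at h1
    field_simp
end fixedproj

section linalg
variable {K : Type*} [RCLike K]

lemma frobSq_nonneg' {ι κ : Type*} [Fintype ι] [Fintype κ] (A : Matrix ι κ K) :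
    0 ≤ frobSq A := by unfold frobSq; positivity

lemma frobSq_eq {ι κ : Type*} [Fintype ι] [Fintype κ] (A : Matrix ι κ K) :
    frobSq A = RCLike.re (A * Aᴴ).trace := by
  simp only [frobSq, Matrix.trace, Matrix.diag, Matrix.mul_apply, conjTranspose_apply, map_sum]
  refine Finset.sum_congr rfl fun i _ => Finset.sum_congr rfl fun j _ => ?_
  rw [RCLike.star_def, RCLike.mul_conj]
  norm_cast

lemma frobSq_eq' {ι κ : Type*} [Fintype ι] [Fintype κ] (A : Matrix ι κ K) :
    frobSq A = RCLike.re (Aᴴ * A).trace := by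
  rw [frobSq_eq, Matrix.trace_mul_comm]

lemma re_trace_conjT {ι : Type*} [Fintype ι] (A : Matrix ι ι K) :
    RCLike.re Aᴴ.trace = RCLike.re A.trace := by
  rw [trace_conjTranspose, RCLike.star_def, RCLike.conj_re]

lemma frobSq_pos {ι κ : Type*} [Fintype ι] [Fintype κ] (A : Matrix ι κ K) (h : A ≠ 0) :
    0 < frobSq A := by
  rcases (frobSq_nonneg' A).lt_or_eq with h1 | h1
  · exact h1
  · exfalso
    apply h
    unfold frobSq at h1
    have h2 := (Finset.sum_eq_zero_iff_of_nonneg (fun i _ => by positivity)).1 h1.symm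
    ext i j
    have h3 := (Finset.sum_eq_zero_iff_of_nonneg (fun i _ => by positivity)).1
      (h2 i (Finset.mem_univ _)) j (Finset.mem_univ _)
    simpa using h3

lemma frobSq_zero' {ι κ : Type*} [Fintype ι] [Fintype κ] : frobSq (0 : Matrix ι κ K) = 0 := by
  simp [frobSq]

/-- Pythagoras, columns. -/
lemma frob_pyth {ι κ τ : Type*} [Fintype ι] [Fintype κ] [Fintype τ] (A : Matrix ι τ K)
    (B : Matrix ι κ K) (C : Matrix τ κ K) (h : Aᴴ * B = 0) :
    frobSq B ≤ frobSq (B - A * C) := by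
  have h' : Bᴴ * A = 0 := by
    rw [← conjTranspose_inj, conjTranspose_mul, conjTranspose_conjTranspose, h]; simp
  have : frobSq (B - A * C) = frobSq B + frobSq (A * C) := by
    rw [frobSq_eq', frobSq_eq', frobSq_eq', ← map_add, ← trace_add]
    congr 2
    rw [conjTranspose_sub, Matrix.sub_mul, Matrix.mul_sub, Matrix.mul_sub, conjTranspose_mul,
      Matrix.mul_assoc Cᴴ Aᴴ B,
      h, ← Matrix.mul_assoc Bᴴ A C, h']
    simp
  rw [this]
  linarith [frobSq_nonneg' (A * C)]

lemma mp_zero {ι κ τ : Type*} [Fintype ι] [Fintype κ] (A : Matrix ι κ K)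
    (X : Matrix κ ι K) (hX : IsMoorePenrose A X) (B : Matrix ι τ K) (h : Aᴴ * B = 0) :
    X * B = 0 := by
  obtain ⟨-, h2, h3, -⟩ := hX
  rw [← h2, Matrix.mul_assoc X A X, ← h3, conjTranspose_mul, Matrix.mul_assoc,
    Matrix.mul_assoc, h]
  simp

lemma mp_eq {ℓ r d : ℕ} (J : Matrix (Fin ℓ) (Fin r) K) (E : Matrix (Fin r) (Fin d) K)
    (hE : E * Eᴴ = 1) (hJ : IsUnit (Jᴴ * J).det) (X : Matrix (Fin d) (Fin ℓ) K)
    (hX : IsMoorePenrose (J * E) X) : E * X = (Jᴴ * J)⁻¹ * Jᴴ := by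
  obtain ⟨h1, -, h3, -⟩ := hX
  have hc : ∀ {κ : Type} (U : Matrix (Fin r) κ K), (Jᴴ * J)⁻¹ * (Jᴴ * J * U) = U := by
    intro κ U
    rw [← Matrix.mul_assoc, nonsing_inv_mul _ hJ, Matrix.one_mul]
  have e1 : E * X * J = 1 := by
    have : J * E * X * (J * E) * Eᴴ = J * E * Eᴴ := by rw [h1]
    rw [Matrix.mul_assoc J E Eᴴ, hE, Matrix.mul_assoc (J * E * X), Matrix.mul_assoc J E Eᴴ, hE,
      Matrix.mul_one] at this
    have h4 : Jᴴ * J * (E * X * J) = Jᴴ * J * 1 := by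
      rw [Matrix.mul_one]
      calc Jᴴ * J * (E * X * J) = Jᴴ * (J * E * X * J) := by simp only [Matrix.mul_assoc]
        _ = Jᴴ * J := by rw [this]
    have := hc (E * X * J)
    rw [h4, hc] at this
    exact this.symm
  have e2 : Jᴴ * J * (E * X) = Jᴴ := by
    have : Jᴴ * (J * E * X)ᴴ = Jᴴ := by
      rw [← conjTranspose_mul]
      congr 1
      rw [Matrix.mul_assoc J E X, Matrix.mul_assoc, e1, Matrix.mul_one]
    rw [h3] at this
    simp only [Matrix.mul_assoc] at this ⊢
    exact this
  have e3 := hc (E * X)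
  rw [e2] at e3
  exact e3.symm

/-- Sketched least-squares operator. -/
def Zop {n ℓ r : ℕ} (W : Matrix (Fin n) (Fin ℓ) K) (G : Matrix (Fin n) (Fin r) K) :
    Matrix (Fin r) (Fin n) K :=
  ((Wᴴ * G)ᴴ * (Wᴴ * G))⁻¹ * (Wᴴ * G)ᴴ * Wᴴ

lemma Zop_le {n ℓ r d p : ℕ} (W : Matrix (Fin n) (Fin ℓ) K) (G : Matrix (Fin n) (Fin r) K)
    (E : Matrix (Fin r) (Fin d) K) (hE : E * Eᴴ = 1) (X : Matrix (Fin d) (Fin ℓ) K)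
    (hX : IsMoorePenrose (Wᴴ * (G * E)) X) (B : Matrix (Fin n) (Fin p) K) (hB : Gᴴ * B = 0) :
    frobSq (B - G * (Zop W G * B)) ≤ frobSq (B - (G * E) * (X * (Wᴴ * B))) := by
  by_cases hJ : IsUnit ((Wᴴ * G)ᴴ * (Wᴴ * G)).det
  · rw [← Matrix.mul_assoc] at hX
    have := mp_eq _ E hE hJ X hX
    apply le_of_eq
    congr 2
    rw [Zop, ← this]
    simp only [Matrix.mul_assoc]
  · have h0 : Zop W G = 0 := by
      rw [Zop, nonsing_inv_apply_not_isUnit _ hJ]; simp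
    rw [h0]
    simp only [Matrix.zero_mul, Matrix.mul_zero, sub_zero]
    rw [Matrix.mul_assoc]
    exact frob_pyth _ _ _ hB

lemma sum_single {n m p : ℕ} (j : Fin p) (T : Matrix (Fin m) (Fin n) K) :
    ∑ i, frobSq (T * (Matrix.single i j (1 : K) : Matrix (Fin n) (Fin p) K)) = frobSq T := by
  have : ∀ i, frobSq (T * (Matrix.single i j (1 : K) : Matrix (Fin n) (Fin p) K)) = ∑ a, ‖T a i‖ ^ 2 := by
    intro i
    unfold frobSq
    refine Finset.sum_congr rfl fun a _ => ?_
    have h1 : ∀ b, 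
        (T * (Matrix.single i j (1 : K) : Matrix (Fin n) (Fin p) K)) a b = if b = j then T a i else 0 := by
      intro b
      rw [Matrix.mul_apply, Finset.sum_eq_single i]
      · by_cases hb : b = j
        · subst hb; simp
        · simp [hb, Ne.symm hb]
      · intro c _ hc
        simp [Matrix.single_apply, hc.symm]
      · simp
    simp_rw [h1]
    rw [Finset.sum_eq_single j]
    · simp
    · intro b _ hb; simp [hb]
    · simp
  rw [Finset.sum_congr rfl fun i _ => this i, Finset.sum_comm]
  rfl

lemma main_ineq {n ℓ r : ℕ} (W : Matrix (Fin n) (Fin ℓ) K) (G : Matrix (Fin n) (Fin r) K)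
    (hW : IsUnit (Wᴴ * W).det) (hG : IsUnit (Gᴴ * G).det) :
    ((n : ℝ) - r) + RCLike.re (Gᴴ * (1 - W * (Wᴴ * W)⁻¹ * Wᴴ) * G *
      (Gᴴ * (W * (Wᴴ * W)⁻¹ * Wᴴ) * G)⁻¹).trace ≤
    frobSq ((1 - G * Zop W G) * (1 - G * (Gᴴ * G)⁻¹ * Gᴴ)) := by
  obtain ⟨p1, p2, p3, p4⟩ := proj_facts W hW
  obtain ⟨g1, g2, g3, g4⟩ := proj_facts G hG
  have hWP : Wᴴ * (W * (Wᴴ * W)⁻¹ * Wᴴ) = Wᴴ := by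
    rw [← Matrix.mul_assoc, ← Matrix.mul_assoc, mul_nonsing_inv _ hW, Matrix.one_mul]
  set P := W * (Wᴴ * W)⁻¹ * Wᴴ with hP
  set PG := G * (Gᴴ * G)⁻¹ * Gᴴ with hPG
  have g5 : Gᴴ * PG = Gᴴ := by
    rw [hPG, ← Matrix.mul_assoc, ← Matrix.mul_assoc, mul_nonsing_inv _ hG, Matrix.one_mul]
  clear_value P PG
  by_cases hK : IsUnit (Gᴴ * P * G).det
  · have hJ : IsUnit ((Wᴴ * G)ᴴ * (Wᴴ * G)).det := by
      rw [gram_isUnit]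
      intro c hc
      have : (Gᴴ * P * G) *ᵥ c = 0 := by
        have : Gᴴ * P * G = Gᴴ * W * (Wᴴ * W)⁻¹ * (Wᴴ * G) := by
          rw [hP]; simp only [Matrix.mul_assoc]
        rw [this, ← mulVec_mulVec, hc, mulVec_zero]
      have h2 := congrArg (fun v => (Gᴴ * P * G)⁻¹ *ᵥ v) this
      simpa [mulVec_mulVec, nonsing_inv_mul _ hK] using h2
    have hZG : Zop W G * G = 1 := by
      rw [Zop, Matrix.mul_assoc, Matrix.mul_assoc, nonsing_inv_mul _ hJ]
    have hZP : Zop W G * P = Zop W G := by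
      rw [Zop, Matrix.mul_assoc, hWP]
    set Z := Zop W G with hZ
    have h1 : (1 - G * Z) * (1 - PG) = 1 - G * Z := by
      have : (1 - G * Z) * PG = 0 := by
        have h0 : (1 - G * Z) * G = 0 := by
          rw [Matrix.sub_mul, Matrix.mul_assoc, hZG]; simp
        rw [hPG, Matrix.mul_assoc G, ← Matrix.mul_assoc, h0]
        simp
      rw [mul_sub, this]; simp
    rw [h1]
    set T := G * Z with hT
    set T0 := G * (Gᴴ * P * G)⁻¹ * Gᴴ * P with hT0
    have hKh : ((Gᴴ * P * G)⁻¹)ᴴ = (Gᴴ * P * G)⁻¹ := by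
      rw [conjTranspose_nonsing_inv]
      congr 1
      rw [conjTranspose_mul, conjTranspose_mul, conjTranspose_conjTranspose, p1.eq,
        Matrix.mul_assoc]
    have hT0h : T0ᴴ = P * G * (Gᴴ * P * G)⁻¹ * Gᴴ := by
      rw [hT0, conjTranspose_mul, conjTranspose_mul, conjTranspose_mul,
        conjTranspose_conjTranspose, p1.eq, hKh]
      simp only [Matrix.mul_assoc]
    have hTT : T * T0ᴴ = G * (Gᴴ * P * G)⁻¹ * Gᴴ := by
      have : T * T0ᴴ = G * ((Z * P) * G) * (Gᴴ * P * G)⁻¹ * Gᴴ := by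
        rw [hT0h, hT]; simp only [Matrix.mul_assoc]
      rw [this, hZP, hZG, Matrix.mul_one]
    have hT00 : T0 * T0ᴴ = G * (Gᴴ * P * G)⁻¹ * Gᴴ := by
      have : T0 * T0ᴴ = G * ((Gᴴ * P * G)⁻¹ * (Gᴴ * (P * P) * G)) * (Gᴴ * P * G)⁻¹ * Gᴴ := by
        rw [hT0h, hT0]; simp only [Matrix.mul_assoc]
      rw [this, p2, nonsing_inv_mul _ hK, Matrix.mul_one]
    have hge : frobSq T0 ≤ frobSq T := by
      have h3 : frobSq (T - T0) = frobSq T - frobSq T0 := by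
        have h5 : T0 * Tᴴ = T0 * T0ᴴ := by
          clear_value T T0
          rw [← conjTranspose_inj, conjTranspose_mul, conjTranspose_mul,
            conjTranspose_conjTranspose, conjTranspose_conjTranspose, hTT, hT00]
        rw [frobSq_eq, conjTranspose_sub, Matrix.sub_mul, Matrix.mul_sub, Matrix.mul_sub, h5, hTT,
          sub_self, sub_zero, trace_sub, map_sub, ← frobSq_eq, ← hT00, ← frobSq_eq]
      linarith [frobSq_nonneg' (T - T0)]
    have hT0v : frobSq T0 = r + RCLike.re (Gᴴ * (1 - P) * G * (Gᴴ * P * G)⁻¹).trace := by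
      rw [frobSq_eq, hT00, Matrix.mul_assoc, Matrix.trace_mul_comm]
      have : (Gᴴ * P * G)⁻¹ * Gᴴ * G = (Gᴴ * P * G)⁻¹ * (Gᴴ * P * G) +
          (Gᴴ * P * G)⁻¹ * (Gᴴ * (1 - P) * G) := by
        rw [Matrix.mul_sub, Matrix.sub_mul, Matrix.mul_sub]
        simp [Matrix.mul_assoc]
      rw [this, trace_add, nonsing_inv_mul _ hK, map_add, Matrix.trace_mul_comm (Gᴴ * P * G)⁻¹]
      simp
    have htrT : RCLike.re T.trace = r := by
      rw [hT, Matrix.trace_mul_comm, hZG]; simp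
    have h4 : frobSq (1 - T) = n - 2 * r + frobSq T := by
      rw [frobSq_eq, conjTranspose_sub, conjTranspose_one, sub_mul, mul_sub, mul_sub,
        Matrix.one_mul, Matrix.one_mul, Matrix.mul_one, trace_sub, trace_sub, trace_sub, map_sub,
        map_sub, map_sub, re_trace_conjT, htrT, ← frobSq_eq]
      simp
      ring
    rw [h4]
    linarith
  · rw [nonsing_inv_apply_not_isUnit _ hK]
    simp only [Matrix.mul_zero, trace_zero, map_zero, add_zero]
    have h1 : (1 - G * Zop W G) * (1 - PG) = (1 - PG) - G * (Zop W G * (1 - PG)) := by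
      rw [sub_mul, Matrix.one_mul, Matrix.mul_assoc]
    rw [h1]
    refine le_trans (le_of_eq ?_) (frob_pyth G (1 - PG) _ (by rw [Matrix.mul_sub, g5]; simp))
    rw [frobSq_eq, conjTranspose_sub, g1.eq, conjTranspose_one, sub_mul, mul_sub, mul_sub, g2]
    simp [g3]

lemma isUnit_of_rank {n ℓ : ℕ} (W : Matrix (Fin n) (Fin ℓ) K) (h : W.rank = ℓ) :
    IsUnit (Wᴴ * W).det := by
  rw [gram_isUnit]
  have h1 : Module.finrank K (LinearMap.ker W.mulVecLin) = 0 := by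
    have := LinearMap.finrank_range_add_finrank_ker W.mulVecLin
    rw [Matrix.rank] at h
    simp at this
    omega
  intro c hc
  have : c ∈ LinearMap.ker W.mulVecLin := by simpa using hc
  rw [Submodule.finrank_eq_zero.1 h1] at this
  simpa using this

lemma rank_GE {n r d : ℕ} (G : Matrix (Fin n) (Fin r) K) (E : Matrix (Fin r) (Fin d) K)
    (hG : IsUnit (Gᴴ * G).det) (hE : E * Eᴴ = 1) : (G * E).rank = r := by
  have h1 : G.rank = r := by
    rw [← rank_conjTranspose_mul_self, rank_of_isUnit _ ((isUnit_iff_isUnit_det _).2 hG)]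
    simp
  apply le_antisymm
  · exact (rank_mul_le_left _ _).trans h1.le
  · have : G = G * E * Eᴴ := by rw [Matrix.mul_assoc, hE, Matrix.mul_one]
    have h2 : G.rank = (G * E * Eᴴ).rank := congrArg Matrix.rank this
    exact h1.symm.le.trans (h2.le.trans (rank_mul_le_left _ _))

lemma exists_E {r d : ℕ} (h : r ≤ d) : ∃ E : Matrix (Fin r) (Fin d) K, E * Eᴴ = 1 := by
  refine ⟨of fun i j => if j = Fin.castLE h i then 1 else 0, ?_⟩
  ext i j
  simp [Matrix.mul_apply, Matrix.one_apply, eq_comm]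
end linalg

section final
variable {K : Type*} [RCLike K]

lemma base_ineq {n ℓ r : ℕ} (W : Matrix (Fin n) (Fin ℓ) K) (G : Matrix (Fin n) (Fin r) K)
    (hG : IsUnit (Gᴴ * G).det) :
    ((n : ℝ) - r) = frobSq (1 - G * (Gᴴ * G)⁻¹ * Gᴴ) ∧
    ((n : ℝ) - r) ≤ frobSq ((1 - G * Zop W G) * (1 - G * (Gᴴ * G)⁻¹ * Gᴴ)) ∧
    Gᴴ * (1 - G * (Gᴴ * G)⁻¹ * Gᴴ) = 0 := by
  obtain ⟨g1, g2, g3, g4⟩ := proj_facts G hG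
  set PG := G * (Gᴴ * G)⁻¹ * Gᴴ with hPG
  have g5 : Gᴴ * PG = Gᴴ := by
    rw [hPG, ← Matrix.mul_assoc, ← Matrix.mul_assoc, mul_nonsing_inv _ hG, Matrix.one_mul]
  clear_value PG
  have h0 : ((n : ℝ) - r) = frobSq (1 - PG) := by
    rw [frobSq_eq, conjTranspose_sub, g1.eq, conjTranspose_one, sub_mul, mul_sub, mul_sub, g2]
    simp [g3]
  have h2 : Gᴴ * (1 - PG) = 0 := by rw [Matrix.mul_sub, g5]; simp
  refine ⟨h0, ?_, h2⟩
  have h1 : (1 - G * Zop W G) * (1 - PG) = (1 - PG) - G * (Zop W G * (1 - PG)) := by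
    rw [sub_mul, Matrix.one_mul, Matrix.mul_assoc]
  rw [h1]
  exact h0.le.trans (frob_pyth G (1 - PG) _ h2)

variable [MeasurableSpace K] [BorelSpace K]

lemma ME.Zop {X : Type*} [MeasurableSpace X] {n ℓ r : ℕ} {f : X → Matrix (Fin n) (Fin ℓ) K}
    {g : X → Matrix (Fin n) (Fin r) K} (hf : ME f) (hg : ME g) :
    ME (fun x => Zop (f x) (g x)) := by
  have h1 := hf.conjT.mul hg
  exact ((h1.conjT.mul h1).inv.mul h1.conjT).mul hf.conjT

lemma ME.proj {X : Type*} [MeasurableSpace X] {n ℓ : ℕ} {f : X → Matrix (Fin n) (Fin ℓ) K}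
    (hf : ME f) : ME (fun x => f x * ((f x)ᴴ * f x)⁻¹ * (f x)ᴴ) :=
  (hf.mul (hf.conjT.mul hf).inv).mul hf.conjT

lemma ME.Phi {X : Type*} [MeasurableSpace X] {n r : ℕ} {f : X → Matrix (Fin n) (Fin n) K}
    {g : X → Matrix (Fin n) (Fin r) K} (hf : ME f) (hg : ME g) :
    Measurable (fun x => Phi (f x) (g x)) :=
  ME.trace ((((hg.conjT.mul ((ME.const 1).sub hf)).mul hg)).mul ((hg.conjT.mul hf).mul hg).inv)

variable {Y : Type*} [MeasurableSpace Y] (μ : Measure Y) [IsProbabilityMeasure μ]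

lemma step_B {n ℓ d p r : ℕ}
    (pinv : (m n : ℕ) → Matrix (Fin m) (Fin n) K → Matrix (Fin n) (Fin m) K)
    (hpinv : ∀ (m n : ℕ) (A : Matrix (Fin m) (Fin n) K), IsMoorePenrose A (pinv m n A))
    (M : Y → Matrix (Fin n) (Fin ℓ) K) (S : ℝ≥0∞)
    (hS : ∀ (A : Matrix (Fin n) (Fin d) K) (B : Matrix (Fin n) (Fin p) K), A.rank = r →
      B - A * (pinv n d A * B) ≠ 0 → (∫⁻ ω, ENNReal.ofReal
            (frobSq (B - A * (pinv ℓ d ((M ω)ᴴ * A) * ((M ω)ᴴ * B)))) ∂μ) /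
          ENNReal.ofReal (frobSq (B - A * (pinv n d A * B))) ≤ S)
    (E : Matrix (Fin r) (Fin d) K) (hE : E * Eᴴ = 1) (G : Matrix (Fin n) (Fin r) K)
    (hG : IsUnit (Gᴴ * G).det) (B : Matrix (Fin n) (Fin p) K) (hB : Gᴴ * B = 0) :
    ∫⁻ ω, ENNReal.ofReal (frobSq (B - G * (Zop (M ω) G * B))) ∂μ ≤
      S * ENNReal.ofReal (frobSq B) := by
  by_cases h0 : B = 0
  · simp [h0, frobSq_zero']
  have hAB : (G * E)ᴴ * B = 0 := by rw [conjTranspose_mul, Matrix.mul_assoc, hB]; simp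
  have hres : B - (G * E) * (pinv n d (G * E) * B) = B := by
    rw [mp_zero _ _ (hpinv n d (G * E)) B hAB]; simp
  have h1 := hS (G * E) B (rank_GE G E hG hE) (by rw [hres]; exact h0)
  rw [hres] at h1
  have hpos := frobSq_pos B h0
  rw [ENNReal.div_le_iff (by simpa using hpos) ENNReal.ofReal_ne_top] at h1
  refine le_trans (lintegral_mono fun ω => ?_) h1
  exact ENNReal.ofReal_le_ofReal (Zop_le (M ω) G E hE _ (hpinv _ _ _) B hB)

lemma step_G {n ℓ d p r : ℕ} (hp : 1 ≤ p)
    (pinv : (m n : ℕ) → Matrix (Fin m) (Fin n) K → Matrix (Fin n) (Fin m) K)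
    (hpinv : ∀ (m n : ℕ) (A : Matrix (Fin m) (Fin n) K), IsMoorePenrose A (pinv m n A))
    (M : Y → Matrix (Fin n) (Fin ℓ) K) (hM : ME M)
    (hMfull : ∀ᵐ ω ∂μ, (M ω).rank = ℓ) (S : ℝ≥0∞)
    (hS : ∀ (A : Matrix (Fin n) (Fin d) K) (B : Matrix (Fin n) (Fin p) K), A.rank = r →
      B - A * (pinv n d A * B) ≠ 0 → (∫⁻ ω, ENNReal.ofReal
            (frobSq (B - A * (pinv ℓ d ((M ω)ᴴ * A) * ((M ω)ᴴ * B)))) ∂μ) /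
          ENNReal.ofReal (frobSq (B - A * (pinv n d A * B))) ≤ S)
    (E : Matrix (Fin r) (Fin d) K) (hE : E * Eᴴ = 1) (G : Matrix (Fin n) (Fin r) K)
    (hG : IsUnit (Gᴴ * G).det) :
    ENNReal.ofReal ((n : ℝ) - r) +
      ∫⁻ ω, ENNReal.ofReal (Phi (M ω * ((M ω)ᴴ * M ω)⁻¹ * (M ω)ᴴ) G) ∂μ ≤
      S * ENNReal.ofReal ((n : ℝ) - r) := by
  obtain ⟨j⟩ : Nonempty (Fin p) := ⟨⟨0, hp⟩⟩
  set PG := G * (Gᴴ * G)⁻¹ * Gᴴ with hPG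
  let B : Fin n → Matrix (Fin n) (Fin p) K := fun i =>
    (1 - PG) * (Matrix.single i j (1 : K) : Matrix (Fin n) (Fin p) K)
  have hB : ∀ i, Gᴴ * B i = 0 := by
    intro i
    change Gᴴ * ((1 - PG) * _) = 0
    rw [← Matrix.mul_assoc, (base_ineq (0 : Matrix (Fin n) (Fin ℓ) K) G hG).2.2, Matrix.zero_mul]
  have hBe : ∀ ω i, B i - G * (Zop (M ω) G * B i) = ((1 - G * Zop (M ω) G) * (1 - PG)) *
      (Matrix.single i j (1 : K) : Matrix (Fin n) (Fin p) K) := by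
    intro ω i
    rw [Matrix.mul_assoc, Matrix.sub_mul, Matrix.one_mul, Matrix.mul_assoc G]
  have hsum := Finset.sum_le_sum fun (i : Fin n) (_ : i ∈ Finset.univ) =>
    step_B μ pinv hpinv M S hS E hE G hG (B i) (hB i)
  rw [← lintegral_finset_sum, ← Finset.mul_sum,
    ← ENNReal.ofReal_sum_of_nonneg (fun i _ => frobSq_nonneg' _)] at hsum
  · have h1 : ∑ i, frobSq (B i) = (n : ℝ) - r := by
      rw [(base_ineq (0 : Matrix (Fin n) (Fin ℓ) K) G hG).1]
      exact sum_single j (1 - PG)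
    rw [h1] at hsum
    refine le_trans ?_ hsum
    have h2 : ENNReal.ofReal ((n : ℝ) - r) = ∫⁻ _, ENNReal.ofReal ((n : ℝ) - r) ∂μ := by simp
    rw [h2, ← lintegral_add_left measurable_const]
    refine lintegral_mono_ae ?_
    filter_upwards [hMfull] with ω hω
    rw [← ENNReal.ofReal_sum_of_nonneg (fun i _ => frobSq_nonneg' _)]
    simp_rw [hBe]
    rw [sum_single]
    have hb := base_ineq (M ω) G hG
    have hm := main_ineq (M ω) G (isUnit_of_rank _ hω) hG
    have hnr : (0 : ℝ) ≤ (n : ℝ) - r := by rw [hb.1]; exact frobSq_nonneg' _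
    rcases le_total (Phi (M ω * ((M ω)ᴴ * M ω)⁻¹ * (M ω)ᴴ) G) 0 with h | h
    · rw [ENNReal.ofReal_of_nonpos h, add_zero]
      exact ENNReal.ofReal_le_ofReal hb.2.1
    · rw [← ENNReal.ofReal_add hnr h]
      exact ENNReal.ofReal_le_ofReal hm
  · intro i _
    refine ENNReal.measurable_ofReal.comp (ME.frob ?_)
    exact (ME.const _).sub ((ME.const _).mul ((hM.Zop (ME.const _)).mul (ME.const _)))

lemma final_bound {n ℓ d p r : ℕ} (hℓn : ℓ ≤ n) (hp : 1 ≤ p)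
    (pinv : (m n : ℕ) → Matrix (Fin m) (Fin n) K → Matrix (Fin n) (Fin m) K)
    (hpinv : ∀ (m n : ℕ) (A : Matrix (Fin m) (Fin n) K), IsMoorePenrose A (pinv m n A))
    (M : Y → Matrix (Fin n) (Fin ℓ) K) (hM : ME M)
    (hMfull : ∀ᵐ ω ∂μ, (M ω).rank = ℓ) (hr : (r : ℝ) ≤ (ℓ : ℝ) - alphaK K)
    (hrd : r ≤ d) (hrn : r < n) (S : ℝ≥0∞)
    (hS : ∀ (A : Matrix (Fin n) (Fin d) K) (B : Matrix (Fin n) (Fin p) K), A.rank = r →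
      B - A * (pinv n d A * B) ≠ 0 → (∫⁻ ω, ENNReal.ofReal
            (frobSq (B - A * (pinv ℓ d ((M ω)ᴴ * A) * ((M ω)ᴴ * B)))) ∂μ) /
          ENNReal.ofReal (frobSq (B - A * (pinv n d A * B))) ≤ S) :
    ENNReal.ofReal
        (1 + ((n : ℝ) - (ℓ : ℝ)) / ((n : ℝ) - (r : ℝ)) *
          ((r : ℝ) / ((ℓ : ℝ) - (r : ℝ) - alphaK K))) ≤ S := by
  obtain ⟨E, hE⟩ := exists_E (K := K) hrd
  have hnr : (0 : ℝ) < (n : ℝ) - r := by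
    have : (r : ℝ) < n := by exact_mod_cast hrn
    linarith
  have hns := ae_nonsing (K := K) (ι := Fin n) r (by simp; omega)
  have hstep := fun (G : Matrix (Fin n) (Fin r) K) (hG : IsUnit (Gᴴ * G).det) =>
    step_G μ hp pinv hpinv M hM hMfull S hS E hE G hG
  have hkey : ENNReal.ofReal ((n : ℝ) - r) + ∫⁻ G, ∫⁻ ω,
      ENNReal.ofReal (Phi (M ω * ((M ω)ᴴ * M ω)⁻¹ * (M ω)ᴴ) (cm G)) ∂μ ∂(gcols K r (Fin n)) ≤
      S * ENNReal.ofReal ((n : ℝ) - r) := by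
    have h2 : ENNReal.ofReal ((n : ℝ) - r) =
      ∫⁻ _, ENNReal.ofReal ((n : ℝ) - r) ∂(gcols K r (Fin n)) := by simp
    have h3 : S * ENNReal.ofReal ((n : ℝ) - r) =
      ∫⁻ _, S * ENNReal.ofReal ((n : ℝ) - r) ∂(gcols K r (Fin n)) := by simp
    rw [h3]
    nth_rw 1 [h2]
    rw [← lintegral_add_left measurable_const]
    refine lintegral_mono_ae ?_
    filter_upwards [hns] with G hG
    exact hstep (cm G) hG
  have hone : 1 ≤ S := by
    have h1 : 1 * ENNReal.ofReal ((n : ℝ) - r) ≤ S * ENNReal.ofReal ((n : ℝ) - r) := by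
      rw [one_mul]; exact le_self_add.trans hkey
    exact (ENNReal.mul_le_mul_iff_left (by simpa using hrn) ENNReal.ofReal_ne_top).1 h1
  by_cases hr0 : r = 0
  · simpa [hr0] using hone
  by_cases hd0 : (ℓ : ℝ) - r - alphaK K = 0
  · simpa [hd0] using hone
  have hb : (0 : ℝ) < (ℓ : ℝ) - r - alphaK K := lt_of_le_of_ne (by linarith) (Ne.symm hd0)
  obtain ⟨m, rfl⟩ := Nat.exists_eq_succ_of_ne_zero hr0
  have ha0 : 0 ≤ alphaK K := by unfold alphaK; split_ifs <;> norm_num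
  have hmℓ : m + 1 ≤ ℓ := by
    have : ((m + 1 : ℕ) : ℝ) ≤ ℓ := by
      have : ((m.succ : ℕ) : ℝ) ≤ ℓ := by linarith
      exact this
    exact_mod_cast this
  have hmeas : Measurable (fun q : (Fin (m + 1) → Fin n → K) × Y => ENNReal.ofReal
      (Phi (M q.2 * ((M q.2)ᴴ * M q.2)⁻¹ * (M q.2)ᴴ) (cm q.1))) := by
    refine ENNReal.measurable_ofReal.comp (ME.Phi (ME.proj ?_) (ME.cm measurable_fst))
    exact fun i j => (hM i j).comp measurable_snd
  have hlow : ENNReal.ofReal (((m + 1 : ℕ) : ℝ) * (n - ℓ) /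
      ((ℓ : ℝ) - ((m + 1 : ℕ) : ℝ) - alphaK K)) ≤ ∫⁻ G, ∫⁻ ω,
      ENNReal.ofReal (Phi (M ω * ((M ω)ᴴ * M ω)⁻¹ * (M ω)ᴴ) (cm G)) ∂μ
        ∂(gcols K (m + 1) (Fin n)) := by
    rw [lintegral_lintegral_swap hmeas.aemeasurable]
    set c := ENNReal.ofReal (((m + 1 : ℕ) : ℝ) * (n - ℓ) /
      ((ℓ : ℝ) - ((m + 1 : ℕ) : ℝ) - alphaK K)) with hc
    calc c = ∫⁻ _, c ∂μ := by simp
      _ ≤ _ := by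
        refine lintegral_mono_ae ?_
        filter_upwards [hMfull] with ω hω
        obtain ⟨p1, p2, p3, -⟩ := proj_facts (M ω) (isUnit_of_rank _ hω)
        exact Phi_lower hℓn hmℓ hb _ p1 p2 (by simpa using p3)
  have hfin := (add_le_add_right hlow (ENNReal.ofReal ((n : ℝ) - (m + 1 : ℕ)))).trans hkey
  have hnl : (0 : ℝ) ≤ (n : ℝ) - ℓ := by
    have : (ℓ : ℝ) ≤ n := by exact_mod_cast hℓn
    linarith
  rw [← ENNReal.ofReal_add hnr.le (div_nonneg (by positivity) hb.le)] at hfin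
  have h4 := ENNReal.div_le_of_le_mul hfin
  rw [← ENNReal.ofReal_div_of_pos hnr] at h4
  refine le_trans (le_of_eq ?_) h4
  congr 1
  simp only [Nat.succ_eq_add_one] at hnr hb ⊢
  have e1 := hnr.ne'
  have e2 := hb.ne'
  generalize (n : ℝ) - ((m + 1 : ℕ) : ℝ) = x at e1 ⊢
  generalize (ℓ : ℝ) - ((m + 1 : ℕ) : ℝ) - alphaK K = y at e2 ⊢
  field_simp
end final

/-- **Sketch-and-solve, sharp lower bound** (Theorem 2.2): for any full-rank random
embedding `Ω`, the worst case over least-squares problems `(A, B)` with `rank A = r`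
of `E‖B − A(Ω*A)⁺(Ω*B)‖_F² / ‖B − AA⁺B‖_F²` is at least
`1 + ((n − ℓ)/(n − r)) · r/(ℓ − r − α_K)`. -/
theorem sketch_and_solve_lower_bound
    {K : Type*} [RCLike K] [MeasurableSpace K] [BorelSpace K]
    {Y : Type*} [MeasurableSpace Y] (μ : Measure Y) [IsProbabilityMeasure μ]
    (pinv : (m n : ℕ) → Matrix (Fin m) (Fin n) K → Matrix (Fin n) (Fin m) K)
    (hpinv : ∀ (m n : ℕ) (A : Matrix (Fin m) (Fin n) K), IsMoorePenrose A (pinv m n A))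
    (n ℓ d p r : ℕ) (hℓn : ℓ ≤ n)
    (M : Y → Matrix (Fin n) (Fin ℓ) K)
    (hMmeas : Measurable M)
    (hMfull : ∀ᵐ ω ∂μ, (M ω).rank = ℓ)
    (hr : (r : ℝ) ≤ (ℓ : ℝ) - alphaK K)
    (hrd : r ≤ d) (hrn : r < n) (hp : 1 ≤ p) :
    ENNReal.ofReal
        (1 + ((n : ℝ) - (ℓ : ℝ)) / ((n : ℝ) - (r : ℝ)) *
          ((r : ℝ) / ((ℓ : ℝ) - (r : ℝ) - alphaK K))) ≤
      ⨆ (A : Matrix (Fin n) (Fin d) K) (B : Matrix (Fin n) (Fin p) K)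
        (_ : A.rank = r) (_ : B - A * (pinv n d A * B) ≠ 0),
        (∫⁻ ω, ENNReal.ofReal
            (frobSq (B - A * (pinv ℓ d ((M ω)ᴴ * A) * ((M ω)ᴴ * B)))) ∂μ) /
          ENNReal.ofReal (frobSq (B - A * (pinv n d A * B))) := by
  refine final_bound μ hℓn hp pinv hpinv M ?_ hMfull hr hrd hrn _ ?_
  · intro i j
    exact (measurable_pi_apply j).comp ((measurable_pi_apply i).comp hMmeas)
  · intro A B h1 h2
    exact le_iSup_of_le A (le_iSup_of_le B (le_iSup_of_le h1 (le_iSup_of_le h2 le_rfl)))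
end
end
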